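/- Let K be a quadratic field and let c ∈ K. Then there do not exist α, β ∈ K such that α has preperiodic type 1₃ under f_c, β has preperiodic type 1₂ under f_c, and β ∉ {f_c(α), −f_c(α)}. (Equivalently, G(f_c,K) contains no subgraph generated by a point of type 1₃ together with a point of type 1₂ whose orbit is disjoint from it.) -/

import Mathlib

/-- The quadratic map `z ↦ z ^ 2 + c`. -/
def fc {K : Type*} [Field K] (c : K) : K → K := fun z => z ^ 2 + c

/-- `α` has exact period `m` under `fc c`. -/
def HasExactPeriod {K : Type*} [Field K] (c : K) (m : ℕ) (α : K) : Prop :=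
  (fc c)^[m] α = α ∧ ∀ j : ℕ, 1 ≤ j → j < m → (fc c)^[j] α ≠ α

/-- `α` has preperiodic type `m_n` under `fc c`: preperiod exactly `n`, eventual period `m`. -/
def HasPreperiodicType {K : Type*} [Field K] (c : K) (m n : ℕ) (α : K) : Prop :=
  HasExactPeriod c m ((fc c)^[n] α) ∧ (fc c)^[n + m - 1] α ≠ (fc c)^[n - 1] α

section TribonacciField

open Polynomial NumberField

/-- The Eisenstein cubic `X ^ 3 - 2 * X ^ 2 + 2`. -/
noncomputable def eisensteinCubic : ℤ[X] := X ^ 3 - C 2 * X ^ 2 + C 2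

theorem eisensteinCubic_monic : eisensteinCubic.Monic := by
  unfold eisensteinCubic; monicity!

theorem eisensteinCubic_natDegree : eisensteinCubic.natDegree = 3 := by
  unfold eisensteinCubic; compute_degree!

theorem eisensteinCubic_isEisensteinAt :
    eisensteinCubic.IsEisensteinAt (Ideal.span {(2 : ℤ)}) where
  leading := by
    rw [eisensteinCubic_monic.leadingCoeff, Ideal.mem_span_singleton]; decide
  mem := by
    intro n hn
    rw [eisensteinCubic_natDegree] at hn
    rw [Ideal.mem_span_singleton]
    unfold eisensteinCubic
    interval_cases n <;> simp
  notMem := by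
    rw [Ideal.span_singleton_pow, Ideal.mem_span_singleton]
    unfold eisensteinCubic
    simp

theorem eisensteinCubic_irreducible : Irreducible eisensteinCubic :=
  eisensteinCubic_isEisensteinAt.irreducible
    ((Ideal.span_singleton_prime (by norm_num)).2 Int.prime_two)
    eisensteinCubic_monic.isPrimitive (by rw [eisensteinCubic_natDegree]; norm_num)

theorem eisensteinCubic_map_irreducible :
    Irreducible (eisensteinCubic.map (algebraMap ℤ ℚ)) :=
  (eisensteinCubic_monic.irreducible_iff_irreducible_map_fraction_map).1
    eisensteinCubic_irreducible

/-- A power basis of a number field exhibiting it as the cubic field of discriminant `-44`. -/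
structure IsTribonacci {K : Type*} [Field K] [NumberField K] (pb : PowerBasis ℚ K) : Prop where
  dim_eq : pb.dim = 3
  gen_pow_three : pb.gen ^ 3 = 2 * pb.gen ^ 2 - 2

namespace IsTribonacci

variable {K : Type*} [Field K] [NumberField K] {pb : PowerBasis ℚ K}

theorem finrank_eq (h : IsTribonacci pb) : Module.finrank ℚ K = 3 := by
  rw [pb.finrank, h.dim_eq]

theorem isIntegral_gen (h : IsTribonacci pb) : IsIntegral ℤ pb.gen := by
  refine ⟨eisensteinCubic, eisensteinCubic_monic, ?_⟩
  simp only [eisensteinCubic, eval₂_add, eval₂_sub, eval₂_mul, eval₂_pow, eval₂_X, eval₂_C]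
  rw [h.gen_pow_three]; simp

theorem minpoly_gen (h : IsTribonacci pb) : minpoly ℤ pb.gen = eisensteinCubic := by
  have h' : aeval pb.gen eisensteinCubic = 0 := by
    simp only [eisensteinCubic, map_add, map_sub, map_mul, map_pow, aeval_X,
      map_ofNat]
    rw [h.gen_pow_three]; ring
  have hd := minpoly.isIntegrallyClosed_dvd h.isIntegral_gen h'
  refine eq_of_monic_of_associated (minpoly.monic h.isIntegral_gen) eisensteinCubic_monic ?_
  exact (minpoly.irreducible h.isIntegral_gen).associated_of_dvd eisensteinCubic_irreducible hd

/-- The basis `1, ω, ω ^ 2` of the cubic field. -/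
noncomputable def basis (h : IsTribonacci pb) : Module.Basis (Fin 3) ℚ K :=
  pb.basis.reindex (finCongr h.dim_eq)

theorem basis_apply (h : IsTribonacci pb) (i : Fin 3) : h.basis i = pb.gen ^ (i : ℕ) := by
  simp [basis]

theorem leftMulMatrix_gen (h : IsTribonacci pb) :
    Algebra.leftMulMatrix h.basis pb.gen = !![0, 0, -2; 1, 0, 0; 0, 1, 2] := by
  have h0 : pb.gen * h.basis 0 = h.basis 1 := by simp [basis_apply]
  have h1 : pb.gen * h.basis 1 = h.basis 2 := by simp [basis_apply]; ring
  have h2 : pb.gen * h.basis 2 = (-2 : ℚ) • h.basis 0 + (2 : ℚ) • h.basis 2 := by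
    simp [basis_apply, Algebra.smul_def]; linear_combination h.gen_pow_three
  ext i j
  rw [Algebra.leftMulMatrix_eq_repr_mul]
  fin_cases j <;> simp only [Fin.zero_eta, Fin.mk_one, Fin.reduceFinMk, h0, h1, h2, map_add,
    map_smul, Module.Basis.repr_self] <;> fin_cases i <;> simp

theorem discr_basis (h : IsTribonacci pb) : Algebra.discr ℚ h.basis = -44 := by
  have h' : Algebra.traceMatrix ℚ h.basis = !![3, 2, 4; 2, 4, 2; 4, 2, 0] := by
    ext i j
    rw [Algebra.traceMatrix_apply, Algebra.traceForm_apply, basis_apply, basis_apply, ← pow_add,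
      Algebra.trace_eq_matrix_trace h.basis, map_pow, h.leftMulMatrix_gen]
    fin_cases i <;> fin_cases j <;>
      simp [pow_succ, Matrix.trace, Fin.sum_univ_succ] <;> norm_num
  rw [Algebra.discr_def, h']
  simp [Matrix.det_fin_three]; norm_num

theorem card_infinitePlace (h : IsTribonacci pb) :
    InfinitePlace.nrRealPlaces K = 1 ∧ InfinitePlace.nrComplexPlaces K = 1 := by
  have h' := InfinitePlace.card_add_two_mul_card_eq_rank K
  rw [h.finrank_eq] at h'
  have hle : InfinitePlace.nrRealPlaces K ≤ 1 := by
    classical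
    rw [InfinitePlace.nrRealPlaces, Fintype.card_le_one_iff]
    have key : ∀ w : {w : InfinitePlace K // w.IsReal}, ∃ x : ℝ, x < 0 ∧
        x ^ 3 = 2 * x ^ 2 - 2 ∧ w.1.embedding pb.gen = x := by
      rintro ⟨w, hw⟩
      have hx : w.embedding pb.gen = (InfinitePlace.embedding_of_isReal hw pb.gen : ℝ) := by simp
      set x := InfinitePlace.embedding_of_isReal hw pb.gen
      have h3 : x ^ 3 = 2 * x ^ 2 - 2 := by
        have := congrArg (InfinitePlace.embedding_of_isReal hw) h.gen_pow_three
        simpa only [map_pow, map_sub, map_mul, map_ofNat] using this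
      refine ⟨x, ?_, h3, hx⟩
      by_contra hneg
      push Not at hneg
      nlinarith [mul_nonneg hneg (sq_nonneg (3 * x - 4)), sq_nonneg (3 * x - 4)]
    intro w₁ w₂
    obtain ⟨x, hx0, hx, hwx⟩ := key w₁
    obtain ⟨y, hy0, hy, hwy⟩ := key w₂
    have hxy : x = y := by
      have : (x - y) * (x ^ 2 + x * y + y ^ 2 - 2 * (x + y)) = 0 := by linear_combination hx - hy
      rcases mul_eq_zero.1 this with h | h
      · linarith
      · nlinarith [mul_pos_of_neg_of_neg hx0 hy0]
    have he : w₁.1.embedding = w₂.1.embedding := by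
      have : w₁.1.embedding.toRatAlgHom = w₂.1.embedding.toRatAlgHom :=
        pb.algHom_ext (by simp [hwx, hwy, hxy])
      ext z
      exact DFunLike.congr_fun this z
    apply Subtype.ext
    rw [← w₁.1.mk_embedding, ← w₂.1.mk_embedding, he]
  omega

/-- The generator as an algebraic integer. -/
noncomputable def ω (h : IsTribonacci pb) : 𝓞 K := ⟨pb.gen, h.isIntegral_gen⟩

theorem coe_ω (h : IsTribonacci pb) : algebraMap (𝓞 K) K h.ω = pb.gen := rfl

theorem ω_pow_three (h : IsTribonacci pb) : h.ω ^ 3 = 2 * h.ω ^ 2 - 2 := by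
  apply RingOfIntegers.ext
  simpa only [map_pow, map_sub, map_mul, map_ofNat, coe_ω] using h.gen_pow_three

theorem discr_int (h : IsTribonacci pb) :
    Algebra.discr ℤ (fun i : Fin 3 => h.ω ^ (i : ℕ)) = -44 := by
  have h' := h.discr_basis
  rw [Algebra.discr_def] at h' ⊢
  have : Algebra.traceMatrix ℚ h.basis =
      (Algebra.traceMatrix ℤ (fun i : Fin 3 => h.ω ^ (i : ℕ))).map (Int.castRingHom ℚ) := by
    ext i j
    simp [Algebra.traceMatrix_apply, Algebra.traceForm_apply, basis_apply, coe_ω,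
      Algebra.coe_trace_int]
  rw [this, ← RingHom.mapMatrix_apply, ← RingHom.map_det] at h'
  rw [eq_intCast] at h'
  exact_mod_cast h'

theorem exists_index (h : IsTribonacci pb) : ∃ d : ℤ, d ^ 2 * discr K = -44 ∧
    ∀ z : 𝓞 K, ∃ a b c : ℤ, d • z = a + b * h.ω + c * h.ω ^ 2 := by
  have hcard : Fintype.card (Module.Free.ChooseBasisIndex ℤ (𝓞 K)) = 3 := by
    rw [← Module.finrank_eq_card_chooseBasisIndex, RingOfIntegers.rank, h.finrank_eq]
  let B : Module.Basis (Fin 3) ℤ (𝓞 K) :=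
    (RingOfIntegers.basis K).reindex (Fintype.equivFinOfCardEq hcard)
  let v : Fin 3 → 𝓞 K := fun i => h.ω ^ (i : ℕ)
  let P : Matrix (Fin 3) (Fin 3) ℤ := B.toMatrix v
  have hv : Matrix.vecMul B (P.map (algebraMap ℤ (𝓞 K))) = v :=
    B.toMatrix_map_vecMul v
  refine ⟨P.det, ?_, fun z => ?_⟩
  · have := Algebra.discr_of_matrix_vecMul (A := ℤ) B P
    rw [hv] at this
    rw [← discr_eq_discr K B, ← this, h.discr_int]
  · have hB : ∀ i, P.det • B i = ∑ j, (P.adjugate j i) • v j := by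
      intro i
      have h1 : Matrix.vecMul v (P.adjugate.map (algebraMap ℤ (𝓞 K))) i = P.det • B i := by
        rw [← hv, Matrix.vecMul_vecMul, ← Matrix.map_mul, Matrix.mul_adjugate,
          Matrix.smul_one_eq_diagonal, Matrix.diagonal_map (map_zero _), Matrix.vecMul_diagonal]
        simp [mul_comm]
      rw [← h1]
      simp [Matrix.vecMul, dotProduct, mul_comm]
    refine ⟨∑ i, B.repr z i * P.adjugate 0 i, ∑ i, B.repr z i * P.adjugate 1 i,
      ∑ i, B.repr z i * P.adjugate 2 i, ?_⟩
    conv_lhs => rw [← B.sum_repr z, Finset.smul_sum]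
    simp_rw [smul_comm P.det, hB, Fin.sum_univ_three]
    simp [v]
    ring

/-- The tribonacci constant as an algebraic integer. -/
noncomputable def τ (h : IsTribonacci pb) : 𝓞 K := 1 - h.ω

theorem τ_pow_three (h : IsTribonacci pb) : h.τ ^ 3 = h.τ ^ 2 + h.τ + 1 := by
  rw [τ]; linear_combination -h.ω_pow_three

theorem exists_repr (h : IsTribonacci pb) (z : 𝓞 K) :
    ∃ a b c : ℤ, z = a + b * h.τ + c * h.τ ^ 2 := by
  obtain ⟨d, hd, hz⟩ := h.exists_index
  obtain ⟨a, b, c, hz⟩ := hz z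
  have hd' : d ∣ 2 := by
    have h1 : d ^ 2 ∣ 44 := ⟨-discr K, by linarith⟩
    have h2 : d ^ 2 ≤ 44 := Int.le_of_dvd (by norm_num) h1
    have h3 : d ≤ 6 := by nlinarith
    have h4 : -6 ≤ d := by nlinarith
    interval_cases d <;> revert h1 <;> decide
  obtain ⟨e, he⟩ := hd'
  have hgen : pb.gen ∈ Algebra.adjoin ℤ ({pb.gen} : Set K) :=
    Algebra.self_mem_adjoin_singleton ℤ pb.gen
  have h2z : (2 : ℤ) • (z : K) ∈ Algebra.adjoin ℤ ({pb.gen} : Set K) := by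
    have : (2 : ℤ) • (z : K) = e • (a + b * pb.gen + c * pb.gen ^ 2) := by
      have := congrArg (algebraMap (𝓞 K) K) hz
      simp only [map_zsmul, map_add, map_mul, map_pow, coe_ω, map_intCast] at this
      rw [← this, he, mul_comm, mul_smul]
    rw [this]
    refine Subalgebra.zsmul_mem _ (Subalgebra.add_mem _ (Subalgebra.add_mem _ ?_ ?_) ?_) _
    · exact Subalgebra.intCast_mem _ _
    · exact Subalgebra.mul_mem _ (Subalgebra.intCast_mem _ _) hgen
    · exact Subalgebra.mul_mem _ (Subalgebra.intCast_mem _ _) (Subalgebra.pow_mem _ hgen _)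
  have hmem := mem_adjoin_of_smul_prime_smul_of_minpoly_isEisensteinAt (p := (2 : ℤ))
    Int.prime_two h.isIntegral_gen z.isIntegral_coe h2z
    (h.minpoly_gen ▸ eisensteinCubic_isEisensteinAt)
  have key : ∀ y ∈ Algebra.adjoin ℤ ({pb.gen} : Set K),
      ∃ a b c : ℤ, y = a + b * pb.gen + c * pb.gen ^ 2 := by
    intro y hy
    induction hy using Algebra.adjoin_induction with
    | mem x hx => exact ⟨0, 1, 0, by rw [Set.mem_singleton_iff.1 hx]; simp⟩
    | algebraMap r => exact ⟨r, 0, 0, by simp⟩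
    | add x y _ _ hx hy =>
      obtain ⟨a, b, c, rfl⟩ := hx
      obtain ⟨a', b', c', rfl⟩ := hy
      exact ⟨a + a', b + b', c + c', by push_cast; ring⟩
    | mul x y _ _ hx hy =>
      obtain ⟨a, b, c, rfl⟩ := hx
      obtain ⟨a', b', c', rfl⟩ := hy
      refine ⟨a * a' - 2 * (b * c' + c * b') - 4 * c * c', a * b' + b * a' - 2 * c * c',
        a * c' + b * b' + c * a' + 2 * (b * c' + c * b') + 4 * c * c', ?_⟩
      push_cast
      linear_combination (b * c' + c * b' + c * c' * (pb.gen + 2) : K) * h.gen_pow_three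
  obtain ⟨a, b, c, hy⟩ := key _ hmem
  refine ⟨a + b + c, -b - 2 * c, c, RingOfIntegers.ext ?_⟩
  refine hy.trans ?_
  simp only [map_add, map_mul, map_pow, map_intCast, τ, map_sub, map_one, coe_ω]
  push_cast
  ring

theorem repr_eq_zero (h : IsTribonacci pb) {a b c : ℤ} (h0 : a + b * h.τ + c * h.τ ^ 2 = 0) :
    a = 0 ∧ b = 0 ∧ c = 0 := by
  have hli := Fintype.linearIndependent_iff.1 h.basis.linearIndependent
    ![(a + b + c : ℚ), -b - 2 * c, c] (by
      have := congrArg (algebraMap (𝓞 K) K) h0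
      simp only [map_add, map_mul, map_pow, map_intCast, τ, map_sub, map_one, coe_ω, map_zero]
        at this
      simp [Fin.sum_univ_three, basis_apply, Algebra.smul_def]
      linear_combination this)
  have h2 : (c : ℚ) = 0 := by simpa using hli 2
  have h1 : (-b - 2 * c : ℚ) = 0 := by simpa using hli 1
  have h3 : (a + b + c : ℚ) = 0 := by simpa using hli 0
  norm_cast at h2
  subst h2
  push_cast at h1 h3
  have hb : (b : ℚ) = 0 := by linarith
  have ha : (a : ℚ) = 0 := by linarith
  exact ⟨by exact_mod_cast ha, by exact_mod_cast hb, rfl⟩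

theorem repr_inj (h : IsTribonacci pb) {a b c a' b' c' : ℤ}
    (he : (a + b * h.τ + c * h.τ ^ 2 : 𝓞 K) = a' + b' * h.τ + c' * h.τ ^ 2) :
    a = a' ∧ b = b' ∧ c = c' := by
  have := h.repr_eq_zero (a := a - a') (b := b - b') (c := c - c')
    (by push_cast; linear_combination he)
  omega

theorem isPrincipalIdealRing (h : IsTribonacci pb) : IsPrincipalIdealRing (𝓞 K) := by
  apply RingOfIntegers.isPrincipalIdealRing_of_abs_discr_lt
  obtain ⟨d, hd, -⟩ := h.exists_index
  have hle : |discr K| ≤ 44 := by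
    have h1 : discr K ∣ 44 := ⟨-d ^ 2, by linarith⟩
    exact Int.le_of_dvd (by norm_num) ((abs_dvd _ _).2 h1)
  rw [h.card_infinitePlace.2, h.finrank_eq]
  have : (|discr K| : ℝ) ≤ 44 := by exact_mod_cast hle
  norm_num [Nat.factorial]
  nlinarith [Real.pi_gt_three]

/-- Squares have even middle coordinate. -/
theorem sq_repr (h : IsTribonacci pb) (a b c : ℤ) :
    (a + b * h.τ + c * h.τ ^ 2 : 𝓞 K) ^ 2 =
      ((a ^ 2 + 2 * b * c + c ^ 2 : ℤ) : 𝓞 K) + ((2 * (a * b + b * c + c ^ 2) : ℤ) : 𝓞 K) * h.τ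
        + ((b ^ 2 + 2 * a * c + 2 * b * c + 2 * c ^ 2 : ℤ) : 𝓞 K) * h.τ ^ 2 := by
  push_cast
  linear_combination (2 * b * c + c ^ 2 * (h.τ + 1) : 𝓞 K) * h.τ_pow_three

/-- The tribonacci constant as a unit. -/
noncomputable def τUnit (h : IsTribonacci pb) : (𝓞 K)ˣ where
  val := h.τ
  inv := h.τ ^ 2 - h.τ - 1
  val_inv := by linear_combination h.τ_pow_three
  inv_val := by linear_combination h.τ_pow_three

theorem unit_eq (h : IsTribonacci pb) (u : (𝓞 K)ˣ) :
    ∃ v : (𝓞 K)ˣ, u = v ^ 2 ∨ u = -v ^ 2 ∨ u = h.τUnit * v ^ 2 ∨ u = -(h.τUnit * v ^ 2) := by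
  have hodd : Odd (Module.finrank ℚ K) := by rw [h.finrank_eq]; decide
  have hrank : Units.rank K = 1 := by
    rw [Units.rank, InfinitePlace.card_eq_nrRealPlaces_add_nrComplexPlaces,
      h.card_infinitePlace.1, h.card_infinitePlace.2]
  obtain ⟨η, hη⟩ : ∃ η : (𝓞 K)ˣ, ∀ u : (𝓞 K)ˣ, ∃ k : ℤ, u = η ^ k ∨ u = -η ^ k := by
    refine ⟨Units.fundSystem K ⟨0, by omega⟩, fun u => ?_⟩
    obtain ⟨⟨ζ, e⟩, hu, -⟩ := Units.exist_unique_eq_mul_prod K u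
    refine ⟨e ⟨0, by omega⟩, ?_⟩
    have hprod : ∏ i, Units.fundSystem K i ^ e i =
        Units.fundSystem K ⟨0, by omega⟩ ^ e ⟨0, by omega⟩ := by
      refine Fintype.prod_eq_single _ fun i hi => (hi ?_).elim
      ext; simp; omega
    simp only [hprod] at hu
    rcases Units.torsion_eq_one_or_neg_one_of_odd_finrank hodd ζ with hζ | hζ
    · left; rw [hu, hζ]; simp
    · right; rw [hu, hζ]; simp
  have hτ : ∀ v : (𝓞 K)ˣ, h.τUnit ≠ v ^ 2 ∧ h.τUnit ≠ -v ^ 2 := by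
    intro v
    obtain ⟨a, b, c, hv⟩ := h.exists_repr v
    have hv2 : (((v ^ 2 : (𝓞 K)ˣ)) : 𝓞 K) = (a + b * h.τ + c * h.τ ^ 2 : 𝓞 K) ^ 2 := by
      rw [← hv]; simp
    rw [sq_repr] at hv2
    constructor
    · intro he
      have he' : h.τ = ((v ^ 2 : (𝓞 K)ˣ) : 𝓞 K) := congrArg Units.val he
      rw [hv2] at he'
      have := (h.repr_inj (a := 0) (b := 1) (c := 0) (a' := a ^ 2 + 2 * b * c + c ^ 2)
        (b' := 2 * (a * b + b * c + c ^ 2)) (c' := b ^ 2 + 2 * a * c + 2 * b * c + 2 * c ^ 2)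
        (by push_cast; push_cast at he'; linear_combination he')).2.1
      omega
    · intro he
      have he' : h.τ = -((v ^ 2 : (𝓞 K)ˣ) : 𝓞 K) := congrArg Units.val he
      rw [hv2] at he'
      have := (h.repr_inj (a := 0) (b := -1) (c := 0) (a' := a ^ 2 + 2 * b * c + c ^ 2)
        (b' := 2 * (a * b + b * c + c ^ 2)) (c' := b ^ 2 + 2 * a * c + 2 * b * c + 2 * c ^ 2)
        (by push_cast; push_cast at he'; linear_combination -he')).2.1
      omega
  obtain ⟨j, hj⟩ := hη h.τUnit
  have hjodd : Odd j := by
    by_contra hev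
    obtain ⟨i, rfl⟩ := Int.not_odd_iff_even.1 hev
    have := hτ (η ^ i)
    rw [zpow_add, ← sq] at hj
    tauto
  obtain ⟨k, hk⟩ := hη u
  rcases Int.even_or_odd k with ⟨i, rfl⟩ | hkodd
  · rw [zpow_add, ← sq] at hk
    exact ⟨η ^ i, by tauto⟩
  · obtain ⟨i, hi⟩ := hkodd.sub_odd hjodd
    have hki : η ^ k = η ^ j * (η ^ i) ^ 2 := by
      rw [show k = j + (i + i) by omega, zpow_add, zpow_add, sq]
    refine ⟨η ^ i, ?_⟩
    rcases hj with hj | hj <;> rcases hk with hk | hk <;> rw [hj, hk, hki] <;> simp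

end IsTribonacci

theorem exists_isTribonacci_of_powerBasis {L : Type} [Field L] [inst : Algebra ℚ L]
    (pb : PowerBasis ℚ L) (hdim : pb.dim = 3) (hgen : pb.gen ^ 3 = 2 * pb.gen ^ 2 - 2) :
    ∃ (K : Type) (_ : Field K) (_ : NumberField K) (pb : PowerBasis ℚ K), IsTribonacci pb := by
  have hfin := pb.finite
  have : CharZero L := algebraRat.charZero L
  obtain rfl : inst = DivisionRing.toRatAlgebra := Subsingleton.elim _ _
  have : NumberField L := { }
  exact ⟨L, inferInstance, this, pb, hdim, hgen⟩

theorem exists_isTribonacci : ∃ (K : Type) (_ : Field K) (_ : NumberField K)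
    (pb : PowerBasis ℚ K), IsTribonacci pb := by
  have : Fact (Irreducible (eisensteinCubic.map (algebraMap ℤ ℚ))) :=
    ⟨eisensteinCubic_map_irreducible⟩
  refine exists_isTribonacci_of_powerBasis
    (AdjoinRoot.powerBasis eisensteinCubic_map_irreducible.ne_zero) ?_ ?_
  · rw [AdjoinRoot.powerBasis_dim, eisensteinCubic_monic.natDegree_map, eisensteinCubic_natDegree]
  · have h := AdjoinRoot.eval₂_root (eisensteinCubic.map (algebraMap ℤ ℚ))
    rw [eval₂_map, eval₂_congr rfl rfl (show eisensteinCubic = X ^ 3 - C 2 * X ^ 2 + C 2 from rfl)]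
      at h
    rw [AdjoinRoot.powerBasis_gen]
    simp only [eval₂_add, eval₂_sub, eval₂_mul, eval₂_pow, eval₂_X, eval₂_C] at h
    rw [map_ofNat] at h
    linear_combination h

namespace IsTribonacci
variable {K : Type*} [Field K] [NumberField K] {pb : PowerBasis ℚ K}

theorem mul_repr (h : IsTribonacci pb) (a b c x y z : ℤ) :
    (a + b * h.τ + c * h.τ ^ 2 : 𝓞 K) * (x + y * h.τ + z * h.τ ^ 2) =
      ((a * x + c * y + b * z + c * z : ℤ) : 𝓞 K) +
        ((b * x + (a + c) * y + (b + 2 * c) * z : ℤ) : 𝓞 K) * h.τ +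
        ((c * x + (b + c) * y + (a + b + 2 * c) * z : ℤ) : 𝓞 K) * h.τ ^ 2 := by
  push_cast
  linear_combination (b * z + c * y + c * z * (h.τ + 1) : 𝓞 K) * h.τ_pow_three

/-- The norm form of `ℤ[τ]` in the basis `1, τ, τ ^ 2`. -/
def normForm (a b c : ℤ) : ℤ :=
  a * ((a + c) * (a + b + 2 * c) - (b + c) * (b + 2 * c)) -
    b * (c * (a + b + 2 * c) - (b + c) * (b + c)) + c * (c * (b + 2 * c) - (a + c) * (b + c))

theorem exists_norm (h : IsTribonacci pb) :
    ∃ N : 𝓞 K →* ℤ, ∀ a b c : ℤ, N (a + b * h.τ + c * h.τ ^ 2) = normForm a b c := by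
  choose A B C hrep using h.exists_repr
  have hN : ∀ {u : 𝓞 K} {a b c : ℤ}, u = a + b * h.τ + c * h.τ ^ 2 →
      normForm (A u) (B u) (C u) = normForm a b c := by
    intro u a b c hu
    obtain ⟨h1, h2, h3⟩ := h.repr_inj ((hrep u).symm.trans hu)
    rw [h1, h2, h3]
  refine ⟨⟨⟨fun u => normForm (A u) (B u) (C u), ?_⟩, fun u v => ?_⟩, fun a b c => hN rfl⟩
  · rw [hN (a := 1) (b := 0) (c := 0) (by simp)]; rfl
  · have huv := h.mul_repr (A u) (B u) (C u) (A v) (B v) (C v)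
    rw [← hrep, ← hrep] at huv
    refine (hN huv).trans ?_
    simp only [normForm]
    ring

theorem dvd_normForm (h : IsTribonacci pb) (a b c : ℤ) :
    (a + b * h.τ + c * h.τ ^ 2 : 𝓞 K) ∣ (normForm a b c : 𝓞 K) := by
  refine ⟨((((a + c) * (a + b + 2 * c) - (b + c) * (b + 2 * c) : ℤ)) : 𝓞 K) +
    ((c * (b + 2 * c) - b * (a + b + 2 * c) : ℤ) : 𝓞 K) * h.τ +
    ((b * (b + c) - c * (a + c) : ℤ) : 𝓞 K) * h.τ ^ 2, ?_⟩
  rw [mul_repr]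
  push_cast [normForm]
  ring

theorem isUnit_of_norm (h : IsTribonacci pb) {N : 𝓞 K →* ℤ}
    (hN : ∀ a b c : ℤ, N (a + b * h.τ + c * h.τ ^ 2) = normForm a b c) {u : 𝓞 K}
    (hu : |N u| = 1) : IsUnit u := by
  obtain ⟨a, b, c, rfl⟩ := h.exists_repr u
  refine isUnit_of_dvd_unit (h.dvd_normForm a b c) ?_
  rw [hN] at hu
  rcases eq_or_eq_neg_of_abs_eq hu with hu | hu <;> simp [hu]

theorem exists_eq_mul_of_even_norm (h : IsTribonacci pb) {N : 𝓞 K →* ℤ}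
    (hN : ∀ a b c : ℤ, N (a + b * h.τ + c * h.τ ^ 2) = normForm a b c) {u : 𝓞 K}
    (hu : 2 ∣ N u) : ∃ v, u = (1 - h.τ) * v ∧ N u = -2 * N v := by
  have hω : N (1 - h.τ) = -2 := by
    have := hN 1 (-1) 0
    norm_num [normForm] at this
    rw [← this, sub_eq_add_neg]
  obtain ⟨a, b, c, hr⟩ := h.exists_repr u
  have hpar : 2 ∣ a + b + c := by
    rw [hr, hN] at hu
    have key : ∀ a b c : ZMod 2, a * ((a + c) * (a + b + 2 * c) - (b + c) * (b + 2 * c)) -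
        b * (c * (a + b + 2 * c) - (b + c) * (b + c)) +
        c * (c * (b + 2 * c) - (a + c) * (b + c)) = a + b + c := by decide
    have := (ZMod.intCast_zmod_eq_zero_iff_dvd _ 2).2 hu
    refine (ZMod.intCast_zmod_eq_zero_iff_dvd _ 2).1 ?_
    push_cast [normForm] at this ⊢
    rw [← key, this]
  obtain ⟨k, hk⟩ := hpar
  obtain rfl : a = 2 * k - b - c := by omega
  have huv : u = (1 - h.τ) * (k * (1 - h.τ ^ 2) - b - c * (h.τ + 1)) := by
    rw [hr]; push_cast; linear_combination (-k : 𝓞 K) * h.τ_pow_three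
  exact ⟨_, huv, by rw [huv, map_mul, hω]⟩

theorem exists_eq_unit_mul_sq_of_norm (h : IsTribonacci pb) {N : 𝓞 K →* ℤ}
    (hN : ∀ a b c : ℤ, N (a + b * h.τ + c * h.τ ^ 2) = normForm a b c) {g : 𝓞 K}
    (hg : |N g| = 1 ∨ |N g| = 4 ∨ |N g| = 16) : ∃ (u : (𝓞 K)ˣ) (v : 𝓞 K), g = u * v ^ 2 := by
  have step : ∀ {m : ℤ} {g : 𝓞 K}, |N g| = 4 * m → ∃ g', g = g' * (1 - h.τ) ^ 2 ∧ |N g'| = m := by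
    intro m g hg
    obtain ⟨g₁, e₁, n₁⟩ := h.exists_eq_mul_of_even_norm hN (u := g)
      ((dvd_abs _ _).1 ⟨2 * m, by rw [hg]; ring⟩)
    have hg₁ : |N g₁| = 2 * m := by rw [n₁, abs_mul] at hg; norm_num at hg; linarith
    obtain ⟨g₂, e₂, n₂⟩ := h.exists_eq_mul_of_even_norm hN (u := g₁)
      ((dvd_abs _ _).1 ⟨m, hg₁⟩)
    refine ⟨g₂, by rw [e₁, e₂]; ring, ?_⟩
    rw [n₂, abs_mul] at hg₁; norm_num at hg₁; linarith
  rcases hg with hg | hg | hg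
  · obtain ⟨u, rfl⟩ := h.isUnit_of_norm hN hg
    exact ⟨u, 1, by simp⟩
  · obtain ⟨g', rfl, hg'⟩ := step (m := 1) (by rw [hg]; rfl)
    obtain ⟨u, rfl⟩ := h.isUnit_of_norm hN hg'
    exact ⟨u, _, rfl⟩
  · obtain ⟨g', rfl, hg'⟩ := step (m := 4) (by rw [hg]; rfl)
    obtain ⟨g'', rfl, hg''⟩ := step (m := 1) (by rw [hg']; rfl)
    obtain ⟨u, rfl⟩ := h.isUnit_of_norm hN hg''
    exact ⟨u, (1 - h.τ) ^ 2, by ring⟩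

theorem exists_unit_mul_sq (h : IsTribonacci pb) {m q n : ℤ} (hmq : IsCoprime m q) (hn : n ≠ 0)
    (he : m ^ 6 - 4 * m ^ 2 * q ^ 2 + 4 * q ^ 3 = n ^ 2) :
    ∃ (u : (𝓞 K)ˣ) (v : 𝓞 K),
      ((m ^ 2 - q : ℤ) + (0 : ℤ) * h.τ + q * h.τ ^ 2 : 𝓞 K) = u * v ^ 2 := by
  have := h.isPrincipalIdealRing
  obtain ⟨N, hN⟩ := h.exists_norm
  set X : 𝓞 K := (m ^ 2 - q : ℤ) + (0 : ℤ) * h.τ + q * h.τ ^ 2 with hX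
  set θ : 𝓞 K := 1 - h.τ ^ 2 with hθ
  have hX' : X = m ^ 2 - q * θ := by rw [hX, hθ]; push_cast; ring
  set Y : 𝓞 K := m ^ 4 + m ^ 2 * q * θ + q ^ 2 * (θ ^ 2 - 4) with hY
  have hθ3 : θ ^ 3 - 4 * θ + 4 = 0 := by
    rw [hθ]; linear_combination (-h.τ ^ 3 - h.τ ^ 2 + h.τ - 1 : 𝓞 K) * h.τ_pow_three
  have hXY : X * Y = n ^ 2 := by
    have he' : (m ^ 6 - 4 * m ^ 2 * q ^ 2 + 4 * q ^ 3 : 𝓞 K) = n ^ 2 := by exact_mod_cast he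
    rw [hX', hY]; linear_combination he' - (q : 𝓞 K) ^ 3 * hθ3
  have hn' : (n : 𝓞 K) ^ 2 ≠ 0 := pow_ne_zero _ (by exact_mod_cast hn)
  have hX0 : X ≠ 0 := fun h0 => hn' (by rw [← hXY, h0, zero_mul])
  have hNX : N X = n ^ 2 := by rw [hX, hN, normForm, ← he]; ring
  obtain ⟨X₁, hX₁⟩ := IsBezout.gcd_dvd_left X Y
  obtain ⟨Y₁, hY₁⟩ := IsBezout.gcd_dvd_right X Y
  obtain ⟨r, s, hrs⟩ := IsBezout.gcd_eq_sum X Y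
  set g := IsBezout.gcd X Y
  have hg0 : g ≠ 0 := fun h0 => hX0 (by rw [hX₁, h0, zero_mul])
  have hcop : IsCoprime X₁ Y₁ := ⟨r, s, mul_left_cancel₀ hg0 (by
    linear_combination hrs - r * hX₁ - s * hY₁)⟩
  obtain ⟨k, hk⟩ : g ∣ n := by
    refine (IsIntegrallyClosed.pow_dvd_pow_iff two_ne_zero).1 ⟨X₁ * Y₁, ?_⟩
    rw [← hXY]; linear_combination Y * hX₁ + g * X₁ * hY₁
  obtain ⟨v, w, hvw⟩ := exists_associated_pow_of_mul_eq_pow' hcop (k := 2) (c := k)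
    (mul_left_cancel₀ (pow_ne_zero 2 hg0) (by
      linear_combination hXY - Y * hX₁ - g * X₁ * hY₁ + (n + g * k) * hk))
  have hXg : X = g * w * v ^ 2 := by rw [hX₁, ← hvw]; ring
  have hgθ : g ∣ 3 * θ ^ 2 - 4 := by
    have hq : IsCoprime (g : 𝓞 K) (q ^ 2) := by
      refine IsCoprime.pow_right (IsCoprime.of_isCoprime_of_dvd_left ?_ ⟨X₁, hX₁⟩)
      have h1 : IsCoprime ((m : 𝓞 K) ^ 2) q := by
        simpa using (hmq.map (Int.castRingHom (𝓞 K))).pow_left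
      rw [hX', sub_eq_add_neg, ← mul_neg]
      exact h1.add_mul_left_left _
    refine hq.dvd_of_dvd_mul_left ⟨Y₁ - X₁ * (m ^ 2 + 2 * q * θ), ?_⟩
    linear_combination hY₁ - (m ^ 2 + 2 * q * θ) * hX₁ - hY + (m ^ 2 + 2 * q * θ) * hX'
  have hN176 : N g ∣ 176 := by
    have h1 : N (3 * θ ^ 2 - 4) = 176 := by
      rw [show (176 : ℤ) = normForm 2 6 0 from rfl, ← hN]
      congr 1
      rw [hθ]; push_cast; linear_combination 3 * (h.τ + 1) * h.τ_pow_three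
    exact h1 ▸ map_dvd N hgθ
  have hsq : |N g| = 1 ∨ |N g| = 4 ∨ |N g| = 16 := by
    have hw : |N w| = 1 := Int.isUnit_iff_abs_eq.1 (w.isUnit.map N)
    have hd : |N g| * N v ^ 2 = n ^ 2 := by
      have := congrArg abs hNX
      rw [hXg, map_mul, map_mul, map_pow, abs_mul, abs_mul, hw, abs_pow, abs_pow, sq_abs,
        sq_abs] at this
      linarith
    obtain ⟨e, rfl⟩ : N v ∣ n := (Int.pow_dvd_pow_iff two_ne_zero).1 ⟨|N g|, by linarith⟩
    have he2 : |N g| = |e| ^ 2 := by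
      rw [sq_abs]
      exact mul_left_cancel₀ (pow_ne_zero 2 (left_ne_zero_of_mul hn)) (by linarith)
    have hd176 : |e| ^ 2 ∣ 176 := he2 ▸ (abs_dvd _ _).2 hN176
    have hle := Int.le_of_dvd (by norm_num) hd176
    have h0 := abs_nonneg e
    have h13 : |e| ≤ 13 := by nlinarith
    rw [he2]
    generalize |e| = e at *
    clear he2 hd hrs
    interval_cases e <;> revert hd176 <;> decide
  obtain ⟨u, z, hz⟩ := h.exists_eq_unit_mul_sq_of_norm hN hsq
  exact ⟨u * w, z * v, by rw [hXg, hz]; push_cast; ring⟩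

theorem exists_coordinates (h : IsTribonacci pb) {m q n : ℤ} (hmq : IsCoprime m q) (hn : n ≠ 0)
    (he : m ^ 6 - 4 * m ^ 2 * q ^ 2 + 4 * q ^ 3 = n ^ 2) :
    ∃ a b c A B C : ℤ, A = a ^ 2 + 2 * b * c + c ^ 2 ∧ B = 2 * (a * b + b * c + c ^ 2) ∧
      C = b ^ 2 + 2 * a * c + 2 * b * c + 2 * c ^ 2 ∧
      ((m ^ 2 - q = A ∧ B = 0 ∧ q = C) ∨ (m ^ 2 - q = C ∧ A + C = 0 ∧ q = B + C)) := by
  obtain ⟨N, hN⟩ := h.exists_norm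
  obtain ⟨u, v, huv⟩ := h.exists_unit_mul_sq hmq hn he
  have hNX : N ((m ^ 2 - q : ℤ) + (0 : ℤ) * h.τ + q * h.τ ^ 2) = n ^ 2 := by
    rw [hN, normForm, ← he]; ring
  have hN1 : N (-1) = -1 := by simpa [normForm] using hN (-1) 0 0
  have hNτ : N h.τ = 1 := by simpa [normForm] using hN 0 1 0
  have hpos : ∀ y, N (-1 * y ^ 2) ≠ n ^ 2 := fun y hy => by
    rw [map_mul, hN1, map_pow] at hy
    have := sq_nonneg (N y)
    have := pow_pos (abs_pos.2 hn) 2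
    rw [sq_abs] at this
    linarith
  obtain ⟨w, hw⟩ := h.unit_eq u
  obtain ⟨a, b, c, hr⟩ := h.exists_repr (w * v)
  have hsq := h.sq_repr a b c
  rw [← hr] at hsq
  refine ⟨a, b, c, _, _, _, rfl, rfl, rfl, ?_⟩
  set A := a ^ 2 + 2 * b * c + c ^ 2
  set B := 2 * (a * b + b * c + c ^ 2)
  set C := b ^ 2 + 2 * a * c + 2 * b * c + 2 * c ^ 2
  have hτ : ((h.τUnit : (𝓞 K)ˣ) : 𝓞 K) = h.τ := rfl
  rcases hw with rfl | rfl | rfl | rfl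
  · obtain ⟨h1, h2, h3⟩ := h.repr_inj (huv.trans (Eq.trans (by push_cast; ring) hsq))
    exact .inl ⟨h1, h2.symm, h3⟩
  · refine (hpos (w * v) ?_).elim
    rw [← hNX, huv]; congr 1; push_cast; ring
  · have hτsq := h.mul_repr A B C 0 1 0
    rw [← hsq] at hτsq
    obtain ⟨h1, h2, h3⟩ := h.repr_inj (huv.trans (Eq.trans (by push_cast [hτ]; ring) hτsq))
    exact .inr ⟨by linarith, by linarith, by linarith⟩
  · refine (hpos (w * v) ?_).elim
    rw [← hNX, huv]
    trans N (h.τ * (-1 * (w * v) ^ 2))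
    · rw [map_mul N h.τ, hNτ, one_mul]
    · congr 1; push_cast [hτ]; ring

end IsTribonacci

theorem exists_coordinates_of_cubic {m q n : ℤ} (hmq : IsCoprime m q) (hn : n ≠ 0)
    (he : m ^ 6 - 4 * m ^ 2 * q ^ 2 + 4 * q ^ 3 = n ^ 2) :
    ∃ a b c A B C : ℤ, A = a ^ 2 + 2 * b * c + c ^ 2 ∧ B = 2 * (a * b + b * c + c ^ 2) ∧
      C = b ^ 2 + 2 * a * c + 2 * b * c + 2 * c ^ 2 ∧
      ((m ^ 2 - q = A ∧ B = 0 ∧ q = C) ∨ (m ^ 2 - q = C ∧ A + C = 0 ∧ q = B + C)) := by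
  obtain ⟨K, _, _, pb, h⟩ := exists_isTribonacci
  exact h.exists_coordinates hmq hn he

theorem Int.not_even_and_even_of_isCoprime {a b : ℤ} (h : IsCoprime a b) (ha : 2 ∣ a)
    (hb : 2 ∣ b) : False :=
  Int.prime_two.not_isUnit (h.isUnit_of_dvd' ha hb)

theorem cubic_ne_zero {s q : ℤ} (h : IsCoprime s q) : s ^ 3 - 4 * s * q ^ 2 + 4 * q ^ 3 ≠ 0 := by
  intro h0
  have hs : 2 ∣ s := Int.prime_two.dvd_of_dvd_pow (n := 3)
    ⟨2 * s * q ^ 2 - 2 * q ^ 3, by linarith⟩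
  refine Int.not_even_and_even_of_isCoprime h hs ?_
  obtain ⟨k, rfl⟩ := hs
  exact Int.prime_two.dvd_of_dvd_pow (n := 3) ⟨k * q ^ 2 - k ^ 3, by linarith⟩

/-- The descent step for `x ^ 2 = (p + q) * (p ^ 3 + 3 * p ^ 2 * q - p * q ^ 2 + q ^ 3)`. -/
theorem exists_smaller_of_cubic {m q n : ℤ} (hmq : IsCoprime m q)
    (he : m ^ 6 - 4 * m ^ 2 * q ^ 2 + 4 * q ^ 3 = n ^ 2) :
    ∃ r s : ℤ, IsCoprime r s ∧ m ^ 2 = (r + s) * (r ^ 3 + 3 * r ^ 2 * s - r * s ^ 2 + s ^ 3) ∧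
      q = r * (r ^ 3 + 2 * r ^ 2 * s - 2 * s ^ 3) := by
  have hn : n ≠ 0 := by
    rintro rfl
    exact cubic_ne_zero hmq.pow_left (s := m ^ 2) (by linarith)
  obtain ⟨a, b, c, A, B, C, hA, hB, hC, ⟨h1, h2, h3⟩ | ⟨h1, h2, h3⟩⟩ :=
    exists_coordinates_of_cubic hmq hn he
  · have hmul : b * -(a + c) = c ^ 2 := by linarith
    have hcop : IsCoprime b (a + c) := by
      refine isCoprime_of_prime_dvd ?_ fun π hπ hb hac => ?_
      · rintro ⟨rfl, hac⟩
        have hc : c = 0 := by simpa using hmul.symm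
        subst hc
        obtain rfl : a = 0 := by linarith
        have hq : q = 0 := by rw [h3, hC]; ring
        subst hq
        have := isCoprime_zero_right.1 hmq
        have hm : m = 0 := by
          have : m ^ 2 = 0 := by rw [hA] at h1; linarith
          simpa using this
        subst hm
        exact not_isUnit_zero this
      · have hc : π ∣ c := hπ.dvd_of_dvd_pow (n := 2) (hmul ▸ hb.mul_right _)
        have ha : π ∣ a := by simpa using dvd_sub hac hc
        have hq : π ∣ q := by
          rw [h3, hC]
          exact dvd_add (dvd_add (dvd_add (hb.pow two_ne_zero) (hc.mul_left _)) (hc.mul_left _))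
            ((hc.pow two_ne_zero).mul_left _)
        have hm : π ∣ m ^ 2 := by
          rw [show m ^ 2 = A + q by linarith, hA]
          exact dvd_add (dvd_add (dvd_add (ha.pow two_ne_zero) (hc.mul_left _))
            (hc.pow two_ne_zero)) hq
        exact hπ.not_isUnit (hmq.isUnit_of_dvd' (hπ.dvd_of_dvd_pow hm) hq)
    obtain ⟨r, hr⟩ := Int.sq_of_isCoprime hcop.neg_right hmul
    by_cases hr0 : r = 0
    · obtain rfl : b = 0 := by rcases hr with rfl | rfl <;> simp [hr0]
      obtain rfl : c = 0 := by simpa using hmul.symm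
      have ha : a ^ 2 = 1 := by
        rw [isCoprime_zero_left, add_zero] at hcop
        exact Int.isUnit_sq hcop
      exact ⟨0, 1, isCoprime_one_right, by linarith, by linarith⟩
    obtain ⟨s, hs⟩ : r ∣ c := by
      refine (Int.pow_dvd_pow_iff two_ne_zero).1 ?_
      rw [← hmul]
      rcases hr with rfl | rfl
      · exact dvd_mul_right _ _
      · exact (dvd_neg.2 dvd_rfl).mul_right _
    have hr2 : r ^ 2 ≠ 0 := pow_ne_zero 2 hr0
    rcases hr with rfl | rfl
    · have hac : a + c = -s ^ 2 := mul_left_cancel₀ hr2 (by rw [hs] at hmul ⊢; linarith)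
      obtain rfl : a = -s ^ 2 - r * s := by linarith
      subst hs
      refine ⟨r, s, ?_, by linarith, by linarith⟩
      rw [hac] at hcop
      exact (IsCoprime.pow_iff two_pos two_pos).1 (by simpa using hcop.neg_right)
    · have hac : a + c = s ^ 2 := mul_left_cancel₀ hr2 (by rw [hs] at hmul ⊢; linarith)
      obtain rfl : a = s ^ 2 - r * s := by linarith
      subst hs
      refine ⟨r, -s, ?_, by linarith, by linarith⟩
      rw [hac] at hcop
      exact ((IsCoprime.pow_iff two_pos two_pos).1 (by simpa using hcop.neg_left)).neg_right
  · exfalso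
    have hm : 2 ∣ m := Int.prime_two.dvd_of_dvd_pow (n := 2)
      ⟨a * b + b * c + c ^ 2 + C, by linarith⟩
    obtain ⟨k, rfl⟩ := hm
    have hq : ¬ 2 ∣ q := fun hq => Int.not_even_and_even_of_isCoprime hmq ⟨k, rfl⟩ hq
    have hb : b % 2 = 1 := by
      by_contra hb
      obtain ⟨b', rfl⟩ : 2 ∣ b := by omega
      refine hq ⟨2 * k ^ 2 - (2 * b' ^ 2 + a * c + 2 * b' * c + c ^ 2), ?_⟩
      rw [hC] at h1; linarith
    have hac : (a * b + b * c + c ^ 2) % 2 = 1 := by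
      have : q + (a * b + b * c + c ^ 2) = 2 * k ^ 2 + 2 * (a * b + b * c + c ^ 2) := by linarith
      omega
    obtain ⟨b', rfl⟩ : ∃ b', b = 2 * b' + 1 := ⟨b / 2, by omega⟩
    have ha : a % 2 = 1 := by
      rcases Int.emod_two_eq_zero_or_one c with hc | hc <;>
      rcases Int.emod_two_eq_zero_or_one a with ha | ha <;>
      simp_all [Int.add_emod, Int.mul_emod, pow_two]
    have hc : c % 2 = 0 := by
      rw [hA, hC] at h2
      by_contra hc
      obtain ⟨a', rfl⟩ : ∃ a', a = 2 * a' + 1 := ⟨a / 2, by omega⟩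
      obtain ⟨c', rfl⟩ : ∃ c', c = 2 * c' + 1 := ⟨c / 2, by omega⟩
      ring_nf at h2
      omega
    obtain ⟨a', rfl⟩ : ∃ a', a = 2 * a' + 1 := ⟨a / 2, by omega⟩
    obtain ⟨c', rfl⟩ : ∃ c', c = 2 * c' := ⟨c / 2, by omega⟩
    rw [hA, hC] at h2
    ring_nf at h2
    omega

theorem eq_zero_of_quartic_one (N : ℕ) : ∀ p q x : ℤ, IsCoprime p q → p ^ 2 + q ^ 2 = N →
    x ^ 2 = (p + q) * (p ^ 3 + 3 * p ^ 2 * q - p * q ^ 2 + q ^ 3) → p = 0 ∨ q = 0 ∨ p + q = 0 := by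
  induction N using Nat.strong_induction_on with
  | _ N ih =>
  intro p q x hpq hN hx
  have pos : ∀ p q m n : ℤ, IsCoprime p q → p ^ 2 + q ^ 2 = N → p + q = m ^ 2 →
      p ^ 3 + 3 * p ^ 2 * q - p * q ^ 2 + q ^ 3 = n ^ 2 → p = 0 ∨ q = 0 ∨ p + q = 0 := by
    intro p q m n hpq hN hm hn
    have hmq : IsCoprime m q := by
      refine (IsCoprime.pow_left_iff two_pos).1 (?_ : IsCoprime (m ^ 2) q)
      rw [← hm]; simpa using hpq.add_mul_left_left 1
    obtain rfl : p = m ^ 2 - q := by linarith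
    obtain ⟨r, s, hrs, hrs1, hrs2⟩ := exists_smaller_of_cubic (n := n) hmq (by rw [← hn]; ring)
    set q₁ := r ^ 3 + 2 * r ^ 2 * s - 2 * s ^ 3 with hq₁
    set p₁ := s ^ 3 + 2 * r * s ^ 2 + 2 * r ^ 2 * s + 2 * r ^ 3 with hp₁
    have hp : m ^ 2 - q = s * p₁ := by rw [hrs1, hrs2, hq₁, hp₁]; ring
    have triv : r = 0 ∨ s = 0 ∨ r + s = 0 → m ^ 2 - q = 0 ∨ q = 0 ∨ m ^ 2 - q + q = 0 := by
      rintro (h | h | h)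
      · right; left; rw [hrs2, h, zero_mul]
      · left; rw [hp, h, zero_mul]
      · right; right; rw [sub_add_cancel, hrs1, h, zero_mul]
    by_contra hcon
    have hcon' := fun h => hcon (triv h)
    have hr : r ≠ 0 := fun h => hcon' (.inl h)
    have hs : s ≠ 0 := fun h => hcon' (.inr (.inl h))
    have hsum : r + s ≠ 0 := fun h => hcon' (.inr (.inr h))
    have hp0 : p₁ ≠ 0 := fun h => hcon (.inl (by rw [hp, h, mul_zero]))
    have hq0 : q₁ ≠ 0 := fun h => hcon (.inr (.inl (by rw [hrs2, h, mul_zero])))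
    have hp1 : 1 ≤ p₁ ^ 2 := by have := sq_pos_of_ne_zero hp0; omega
    have hq1 : 1 ≤ q₁ ^ 2 := by have := sq_pos_of_ne_zero hq0; omega
    have hr1 := sq_pos_of_ne_zero hr
    have hs1 := sq_pos_of_ne_zero hs
    refine hcon' (ih (r ^ 2 + s ^ 2).toNat ?_ r s m hrs ?_ hrs1)
    · have hle : r ^ 2 + s ^ 2 < N := by
        rw [← hN, hp, hrs2, mul_pow, mul_pow]
        by_contra! hge
        have hp2 : p₁ ^ 2 = 1 := by nlinarith
        have hq2 : q₁ ^ 2 = 1 := by nlinarith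
        have : (p₁ - q₁) * (p₁ + q₁) = 0 := by linarith
        rcases mul_eq_zero.1 this with h | h
        · have h' : (r + s) * (3 * s ^ 2 - r * s + r ^ 2) = 0 := by rw [← h, hp₁, hq₁]; ring
          rcases mul_eq_zero.1 h' with h | h
          · exact hsum h
          · nlinarith [sq_nonneg (r - s)]
        · have key : ∀ r s : ZMod 5, s ^ 3 + 2 * r * s ^ 2 + 2 * r ^ 2 * s + 2 * r ^ 3 +
              (r ^ 3 + 2 * r ^ 2 * s - 2 * s ^ 3) = 0 → r = 0 ∧ s = 0 := by decide
          obtain ⟨h1, h2⟩ := key r s (by rw [hp₁, hq₁] at h; exact_mod_cast congrArg Int.cast h)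
          have h1 := (ZMod.intCast_zmod_eq_zero_iff_dvd _ 5).1 h1
          have h2 := (ZMod.intCast_zmod_eq_zero_iff_dvd _ 5).1 h2
          have := Int.isUnit_iff.1 (hrs.isUnit_of_dvd' h1 h2)
          norm_num at this
      omega
    · rw [Int.toNat_of_nonneg (by positivity)]
  by_cases hs0 : p + q = 0
  · exact .inr (.inr hs0)
  have hsq : IsCoprime (p + q) q := by simpa using hpq.add_mul_left_left 1
  have hD : p ^ 3 + 3 * p ^ 2 * q - p * q ^ 2 + q ^ 3 =
      (p + q) ^ 3 - 4 * (p + q) * q ^ 2 + 4 * q ^ 3 := by ring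
  obtain ⟨m, hm⟩ : ∃ m, p + q = m ^ 2 ∨ p + q = -m ^ 2 := by
    rw [hD] at hx
    generalize p + q = s at hx hsq
    rcases Int.even_or_odd s with hs | hs
    · obtain ⟨k, rfl⟩ := hs.two_dvd
      have hq : ¬ 2 ∣ q := Int.not_even_and_even_of_isCoprime hsq ⟨k, rfl⟩
      obtain ⟨y, rfl⟩ : 2 ∣ x := Int.prime_two.dvd_of_dvd_pow (n := 2)
        ⟨4 * k * (2 * k ^ 3 - 2 * k * q ^ 2 + q ^ 3), by rw [hx]; ring⟩
      obtain ⟨z, rfl⟩ : 2 ∣ y := Int.prime_two.dvd_of_dvd_pow (n := 2)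
        ⟨k * (2 * k ^ 3 - 2 * k * q ^ 2 + q ^ 3), by linarith⟩
      have hk : 2 ∣ k := by
        refine (Int.prime_two.dvd_or_dvd (b := 2 * k ^ 3 - 2 * k * q ^ 2 + q ^ 3)
          ⟨z ^ 2, by linarith⟩).resolve_right fun h => hq ?_
        refine Int.prime_two.dvd_of_dvd_pow (n := 3) ((Int.dvd_add_right ?_).1 h)
        exact ⟨k ^ 3 - k * q ^ 2, by ring⟩
      obtain ⟨j, rfl⟩ := hk
      have hjq : IsCoprime j (q ^ 3) :=
        (hsq.of_isCoprime_of_dvd_left ⟨4, by ring⟩).pow_right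
      obtain ⟨m, hm⟩ := Int.sq_of_isCoprime (a := j) (c := z)
        (hjq.add_mul_left_right (16 * j ^ 2 - 4 * q ^ 2)) (by linarith)
      exact ⟨2 * m, by rcases hm with rfl | rfl <;> [left; right] <;> ring⟩
    · have h4 : IsCoprime s (2 ^ 2) := (Int.isCoprime_two_right.2 hs).pow_right
      have hcop := (h4.mul_right (hsq.pow_right (n := 3))).add_mul_left_right (s ^ 2 - 4 * q ^ 2)
      exact Int.sq_of_isCoprime hcop (by rw [hx]; ring)
  obtain ⟨n, rfl⟩ : m ∣ x := by
    refine (Int.pow_dvd_pow_iff two_ne_zero).1 ?_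
    rw [hx]
    rcases hm with hm | hm <;> rw [hm]
    · exact dvd_mul_right _ _
    · exact (dvd_neg.2 dvd_rfl).mul_right _
  have hm0 : m ^ 2 ≠ 0 := by
    intro h; rw [h] at hm; simp at hm; exact hs0 hm
  rcases hm with hm | hm
  · exact pos p q m n hpq hN hm (mul_left_cancel₀ hm0 (by rw [hm] at hx; linarith))
  · have := pos (-p) (-q) m n hpq.neg_neg (by rw [← hN]; ring) (by linarith)
      (mul_left_cancel₀ hm0 (by rw [hm] at hx; linarith))
    omega

theorem isCoprime_num_den (t : ℚ) : IsCoprime t.num (t.den : ℤ) :=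
  Int.isCoprime_iff_gcd_eq_one.2 t.reduced

theorem eq_zero_or_eq_neg_one_of_sq_eq {t x : ℚ}
    (h : x ^ 2 = (t + 1) * (t ^ 3 + 3 * t ^ 2 - t + 1)) : t = 0 ∨ t = -1 := by
  have hq : (t.den : ℚ) ≠ 0 := by exact_mod_cast t.den_ne_zero
  have ht : t = t.num / t.den := t.num_div_den.symm
  obtain ⟨y, hy⟩ : IsSquare ((t.num + t.den) *
      (t.num ^ 3 + 3 * t.num ^ 2 * t.den - t.num * t.den ^ 2 + (t.den : ℤ) ^ 3)) := by
    rw [← Rat.isSquare_intCast_iff]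
    refine ⟨x * t.den ^ 2, ?_⟩
    push_cast
    rw [← sq, mul_pow, h]
    generalize (t.num : ℚ) = p at *
    generalize (t.den : ℚ) = q at *
    subst ht
    field_simp
  rcases eq_zero_of_quartic_one _ t.num t.den y (isCoprime_num_den t)
    (Int.toNat_of_nonneg (by positivity)).symm (by rw [hy]; ring) with h | h | h
  · left; exact Rat.num_eq_zero.1 h
  · exact (t.den_ne_zero (by exact_mod_cast h)).elim
  · right
    have : (t.num : ℚ) + t.den = 0 := by exact_mod_cast h
    rw [ht]; field_simp; linarith

end TribonacciField

theorem Int.exists_four_factors {k l g h : ℤ} (hk : k ≠ 0) (he : k * l = g * h) :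
    ∃ r s u v, k = r * s ∧ l = u * v ∧ g = r * u ∧ h = s * v := by
  obtain ⟨r, s, ⟨u, rfl⟩, ⟨v, rfl⟩, rfl⟩ :=
    exists_dvd_and_dvd_of_dvd_mul (Dvd.intro l he : k ∣ g * h)
  exact ⟨r, s, u, v, rfl, mul_left_cancel₀ hk (by rw [he]; ring), rfl, rfl⟩

theorem Int.exists_eq_mul_sq {r v P R : ℤ} (hrv : IsCoprime r v)
    (he : r ^ 2 * P = v ^ 2 * R) : ∃ κ, P = κ * v ^ 2 ∧ R = κ * r ^ 2 := by
  by_cases hv : v = 0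
  · subst hv
    have hr : r ^ 2 = 1 := Int.isUnit_sq (isCoprime_zero_right.1 hrv)
    exact ⟨R, by rw [hr] at he; linarith, by rw [hr, mul_one]⟩
  · obtain ⟨κ, rfl⟩ := (hrv.symm.pow (m := 2) (n := 2)).dvd_of_dvd_mul_left (Dvd.intro R he.symm)
    exact ⟨κ, by ring, mul_left_cancel₀ (pow_ne_zero 2 hv) (by linarith)⟩

/-- A nonnegative factor of a square that is coprime to its cofactor is a square. -/
theorem Int.exists_sq_of_nonneg {a b c : ℤ} (hab : IsCoprime a b) (ha : 0 ≤ a)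
    (h : a * b = c ^ 2) : ∃ d, a = d ^ 2 := by
  obtain ⟨d, hd | hd⟩ := Int.sq_of_isCoprime hab h
  · exact ⟨d, hd⟩
  · exact ⟨0, by nlinarith [sq_nonneg d]⟩

theorem Int.odd_of_not_two_dvd {a : ℤ} (h : ¬ 2 ∣ a) : Odd a := by
  rw [← Int.not_even_iff_odd, even_iff_two_dvd]; exact h

theorem Int.exists_sq_add_three_sq {M n w : ℤ} (hMn : IsCoprime M n) (hM : Odd M) (hn : n ≠ 0)
    (he : M ^ 2 - 12 * n ^ 2 = w ^ 2) : ∃ g h, n = g * h ∧ IsCoprime g h ∧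
      (M = 3 * g ^ 2 + h ^ 2 ∨ M = -(3 * g ^ 2 + h ^ 2)) := by
  have hw : Odd w := by
    have : Odd (w ^ 2) := by
      rw [← he]; exact (hM.pow).sub_even ⟨6 * n ^ 2, by ring⟩
    exact (Int.odd_pow' two_ne_zero).1 this
  obtain ⟨X, hX⟩ : (2 : ℤ) ∣ M - w := (hM.sub_odd hw).two_dvd
  obtain ⟨Y, hY⟩ : (2 : ℤ) ∣ M + w := (hM.add_odd hw).two_dvd
  have hXY : X * Y = 3 * n ^ 2 := by
    have : 4 * (X * Y) = 4 * (3 * n ^ 2) := by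
      rw [show 4 * (X * Y) = (2 * X) * (2 * Y) by ring, ← hX, ← hY]; linarith
    linarith
  have hMXY : M = X + Y := by linarith
  have hcop : IsCoprime X Y := by
    refine isCoprime_of_prime_dvd ?_ fun π hπ hπX hπY => ?_
    · rintro ⟨rfl, rfl⟩
      simp [hn] at hXY
    · have hπn : IsCoprime (π * π) (n ^ 2) := by
        have := hMn.of_isCoprime_of_dvd_left (hMXY ▸ dvd_add hπX hπY)
        exact (this.mul_left this).pow_right
      have h3 : π * π ∣ 3 := hπn.dvd_of_dvd_mul_right (hXY ▸ mul_dvd_mul hπX hπY)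
      have hle := Int.le_of_dvd (by norm_num) h3
      have h1 : π ≤ 1 := by nlinarith
      have h2 : -1 ≤ π := by nlinarith
      have := hπ.ne_zero
      have := mt Int.isUnit_iff.2 hπ.not_isUnit
      omega
  have key : ∀ X Y : ℤ, M = X + Y → X * Y = 3 * n ^ 2 → IsCoprime X Y → 3 ∣ X →
      ∃ g h, n = g * h ∧ IsCoprime g h ∧
        (M = 3 * g ^ 2 + h ^ 2 ∨ M = -(3 * g ^ 2 + h ^ 2)) := by
    rintro _ Y hM hXY hcop ⟨Z, rfl⟩
    have hZY : Z * Y = n ^ 2 := by linarith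
    have hcop' : IsCoprime Z Y := hcop.of_mul_left_right
    obtain ⟨g, hg⟩ := Int.sq_of_isCoprime hcop' hZY
    have hg0 : g ^ 2 ≠ 0 := by
      intro h0
      rw [h0] at hg
      have : n ^ 2 = 0 := by rw [← hZY]; rcases hg with rfl | rfl <;> simp
      exact hn (by simpa using this)
    obtain ⟨h, rfl⟩ : g ∣ n := by
      refine (Int.pow_dvd_pow_iff two_ne_zero).1 ?_
      rw [← hZY]
      rcases hg with rfl | rfl
      · exact dvd_mul_right _ _
      · exact (dvd_neg.2 dvd_rfl).mul_right _
    refine ⟨g, h, rfl, ?_, ?_⟩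
    · have hgZ : g ∣ Z := by
        rcases hg with rfl | rfl
        · exact dvd_pow_self _ two_ne_zero
        · exact (dvd_pow_self _ two_ne_zero).neg_right
      have hhY : h ∣ Y := by
        rcases hg with rfl | rfl
        · exact ⟨h, mul_left_cancel₀ hg0 (by linarith)⟩
        · exact ⟨-h, mul_left_cancel₀ hg0 (by linarith)⟩
      exact (hcop'.of_isCoprime_of_dvd_left hgZ).of_isCoprime_of_dvd_right hhY
    · rcases hg with rfl | rfl
      · left; rw [hM, show Y = h ^ 2 from mul_left_cancel₀ hg0 (by linarith)]
      · right; rw [hM, show Y = -h ^ 2 from mul_left_cancel₀ hg0 (by linarith)]; ring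
  rcases Int.prime_three.dvd_or_dvd (Dvd.intro _ hXY.symm) with h3 | h3
  · exact key X Y hMXY hXY hcop h3
  · exact key Y X (by linarith) (by linarith) hcop.symm h3

theorem Int.natAbs_lt_of_eq_two_mul {z t w : ℤ} (hz : z ≠ 0) (h : z = 2 * t * w) :
    w.natAbs < z.natAbs := by
  subst h
  have ht : t.natAbs ≠ 0 := by rintro h; simp_all
  have hw : w.natAbs ≠ 0 := by rintro h; simp_all
  rw [Int.natAbs_mul, Int.natAbs_mul]
  have : 1 ≤ t.natAbs := by omega
  have : w.natAbs ≤ t.natAbs * w.natAbs := Nat.le_mul_of_pos_left _ this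
  rw [mul_assoc]
  change _ < 2 * _
  omega

theorem Int.exists_of_sq_add_sq {x y z : ℤ} (hxy : IsCoprime x y) (hx : Odd x)
    (h : x ^ 2 + y ^ 2 = z ^ 2) : ∃ m n, x = m ^ 2 - n ^ 2 ∧ y = 2 * m * n ∧ IsCoprime m n ∧
      Odd (m + n) := by
  have hz : PythagoreanTriple x y z := by rw [PythagoreanTriple]; linarith
  obtain ⟨m, n, h1, -, h2, h3⟩ := PythagoreanTriple.coprime_classification.1
    ⟨hz, Int.isCoprime_iff_gcd_eq_one.1 hxy⟩
  rcases h1 with h1 | h1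
  · exact ⟨m, n, h1.1, h1.2, Int.isCoprime_iff_gcd_eq_one.2 h2, Int.odd_iff.2 (by omega)⟩
  · rw [h1.1, mul_assoc] at hx
    exact (Int.not_even_iff_odd.2 hx (even_two_mul _)).elim

theorem Int.exists_sq_sub_sq {x y B : ℤ} (hxy : IsCoprime x y) (hx : Odd x) (hy : y ≠ 0)
    (he : x ^ 2 + 4 * y ^ 2 = B ^ 2) :
    ∃ g h, x = h ^ 2 - g ^ 2 ∧ y = g * h ∧ IsCoprime g h := by
  have hB : Odd B := by
    have : Odd (B ^ 2) := by
      rw [← he]; exact (hx.pow).add_even ⟨2 * y ^ 2, by ring⟩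
    exact (Int.odd_pow' two_ne_zero).1 this
  obtain ⟨X, hX⟩ : (2 : ℤ) ∣ B - x := (hB.sub_odd hx).two_dvd
  obtain ⟨Y, hY⟩ : (2 : ℤ) ∣ B + x := (hB.add_odd hx).two_dvd
  have hXY : X * Y = y ^ 2 := by
    have : 4 * (X * Y) = 4 * y ^ 2 := by
      rw [show 4 * (X * Y) = (2 * X) * (2 * Y) by ring, ← hX, ← hY]; linarith
    linarith
  have hxXY : x = Y - X := by linarith
  have hcop : IsCoprime X Y := by
    refine isCoprime_of_prime_dvd ?_ fun π hπ hπX hπY => ?_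
    · rintro ⟨rfl, rfl⟩
      exact hy (by simpa using hXY.symm)
    · exact hπ.not_isUnit (hxy.isUnit_of_dvd' (hxXY ▸ dvd_sub hπY hπX)
        (hπ.dvd_of_dvd_pow (hXY ▸ hπX.mul_right Y)))
  obtain ⟨g, hg⟩ := Int.sq_of_isCoprime hcop hXY
  have hg0 : g ^ 2 ≠ 0 := by
    intro h0
    rw [h0] at hg
    have : y ^ 2 = 0 := by rw [← hXY]; rcases hg with rfl | rfl <;> simp
    exact hy (by simpa using this)
  obtain ⟨h, rfl⟩ : g ∣ y := by
    refine (Int.pow_dvd_pow_iff two_ne_zero).1 ?_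
    rw [← hXY]
    rcases hg with rfl | rfl
    · exact dvd_mul_right _ _
    · exact (dvd_neg.2 dvd_rfl).mul_right _
  rcases hg with rfl | rfl
  · obtain rfl : Y = h ^ 2 := mul_left_cancel₀ hg0 (by linarith)
    exact ⟨g, h, hxXY, rfl, (IsCoprime.pow_iff two_pos two_pos).1 hcop⟩
  · obtain rfl : Y = -h ^ 2 := mul_left_cancel₀ hg0 (by linarith)
    exact ⟨h, g, by rw [hxXY]; ring, mul_comm _ _,
      (IsCoprime.pow_iff two_pos two_pos).1 (by simpa using hcop.neg_neg.symm)⟩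

theorem Int.not_three_dvd_sq_add_sq {s u : ℤ} (h : IsCoprime s u) : ¬ 3 ∣ s ^ 2 + u ^ 2 := by
  intro hd
  have key : ∀ s u : ZMod 3, s ^ 2 + u ^ 2 = 0 → s = 0 ∧ u = 0 := by decide
  obtain ⟨h1, h2⟩ := key s u (by exact_mod_cast (ZMod.intCast_zmod_eq_zero_iff_dvd _ 3).2 hd)
  exact Int.prime_three.not_isUnit (h.isUnit_of_dvd'
    ((ZMod.intCast_zmod_eq_zero_iff_dvd _ 3).1 h1) ((ZMod.intCast_zmod_eq_zero_iff_dvd _ 3).1 h2))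

theorem Int.sq_add_sq_eq_of_coprime {r v s u : ℤ} (hrv : IsCoprime r v) (hsu : IsCoprime s u)
    (he : r ^ 2 * (s ^ 2 + 4 * u ^ 2) = v ^ 2 * (s ^ 2 + u ^ 2)) :
    s ^ 2 + u ^ 2 = r ^ 2 ∧ s ^ 2 + 4 * u ^ 2 = v ^ 2 := by
  obtain ⟨κ, h1, h2⟩ := Int.exists_eq_mul_sq hrv he
  have hs0 : 0 < s ^ 2 + u ^ 2 := by
    by_contra! hle
    obtain rfl : s = 0 := by nlinarith [sq_nonneg u]
    obtain rfl : u = 0 := by nlinarith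
    exact not_isUnit_zero (isCoprime_zero_right.1 hsu)
  have hκ : 0 < κ := by
    by_contra! hle
    nlinarith [sq_nonneg r]
  have hcop : IsCoprime κ 3 := by
    refine ((Int.prime_three.coprime_iff_not_dvd).2 fun h3 => ?_).symm
    exact Int.not_three_dvd_sq_add_sq hsu (h2 ▸ h3.mul_right _)
  have hu : κ ∣ u ^ 2 := hcop.dvd_of_dvd_mul_left ⟨v ^ 2 - r ^ 2, by linarith⟩
  have hs : κ ∣ s ^ 2 := (Int.dvd_add_left hu).1 ⟨r ^ 2, h2⟩
  have := Int.isUnit_iff.1 ((hsu.pow (m := 2) (n := 2)).isUnit_of_dvd' hs hu)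
  obtain rfl : κ = 1 := by omega
  exact ⟨by linarith, by linarith⟩

theorem eq_zero_of_sq_add_sq_of_sq_add_four_mul_sq (N : ℕ) : ∀ x y A B : ℤ, IsCoprime x y →
    (x * y).natAbs = N → x ^ 2 + y ^ 2 = A ^ 2 → x ^ 2 + 4 * y ^ 2 = B ^ 2 → x * y = 0 := by
  induction N using Nat.strong_induction_on with
  | _ N ih =>
  intro x y A B hxy hN hA hB
  by_contra hne
  have hy : y ≠ 0 := right_ne_zero_of_mul hne
  by_cases hx : 2 ∣ x
  · obtain ⟨z, rfl⟩ := hx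
    obtain ⟨C, rfl⟩ : 2 ∣ B := Int.prime_two.dvd_of_dvd_pow (n := 2)
      ⟨2 * z ^ 2 + 2 * y ^ 2, by rw [← hB]; ring⟩
    have hlt := Int.natAbs_lt_of_eq_two_mul (t := 1) (w := y * z) hne (by ring)
    have := ih _ (hN ▸ hlt) y z C A (hxy.of_mul_left_right.symm) rfl (by linarith) (by linarith)
    exact hne (by rw [show 2 * z * y = 2 * (y * z) by ring, this, mul_zero])
  · obtain ⟨a, b, rfl, rfl, hab, -⟩ := Int.exists_of_sq_add_sq hxy (Int.odd_of_not_two_dvd hx) hA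
    obtain ⟨g, h, hx', hgh, hcop⟩ := Int.exists_sq_sub_sq hxy (Int.odd_of_not_two_dvd hx) hy hB
    have ha : a ≠ 0 := by rintro rfl; simp at hy
    rcases Int.prime_two.dvd_or_dvd (a := g) (b := h) ⟨a * b, by linarith⟩ with ⟨g, rfl⟩ | ⟨h, rfl⟩
    · obtain ⟨r, s, u, v, rfl, rfl, rfl, rfl⟩ := Int.exists_four_factors (l := b) ha
        (show _ = g * h by linarith)
      have hsu : IsCoprime s u := hab.of_mul_left_right.of_mul_right_left
      have hrv : IsCoprime r v := hab.of_mul_left_left.of_mul_right_right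
      obtain ⟨h1, h2⟩ := Int.sq_add_sq_eq_of_coprime hrv hsu (by linarith)
      have hlt := Int.natAbs_lt_of_eq_two_mul (w := s * u)
        (t := r * v * ((r * s) ^ 2 - (u * v) ^ 2)) hne (by ring)
      have := ih _ (hN ▸ hlt) s u r v hsu rfl h1 h2
      exact hy (by rw [show 2 * (r * s) * (u * v) = 2 * r * v * (s * u) by ring, this, mul_zero])
    · obtain ⟨r, s, u, v, rfl, rfl, rfl, rfl⟩ := Int.exists_four_factors (l := b) ha
        (show _ = g * h by linarith)
      have hsu : IsCoprime u s := hab.of_mul_left_right.of_mul_right_left.symm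
      have hrv : IsCoprime v r := hab.of_mul_left_left.of_mul_right_right.symm
      obtain ⟨h1, h2⟩ := Int.sq_add_sq_eq_of_coprime hrv hsu (by linarith)
      have hlt := Int.natAbs_lt_of_eq_two_mul (w := u * s)
        (t := r * v * ((r * s) ^ 2 - (u * v) ^ 2)) hne (by ring)
      have := ih _ (hN ▸ hlt) u s v r hsu rfl h1 h2
      exact hy (by rw [show 2 * (r * s) * (u * v) = 2 * r * v * (u * s) by ring, this, mul_zero])

theorem Int.sq_mod_eight (a : ℤ) :
    a % 2 = 1 ∧ a ^ 2 % 8 = 1 ∨ a % 2 = 0 ∧ (a ^ 2 % 8 = 0 ∨ a ^ 2 % 8 = 4) := by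
  have h : a % 8 = 0 ∨ a % 8 = 1 ∨ a % 8 = 2 ∨ a % 8 = 3 ∨ a % 8 = 4 ∨ a % 8 = 5 ∨ a % 8 = 6 ∨
    a % 8 = 7 := by omega
  rcases h with h | h | h | h | h | h | h | h <;> simp [pow_two, Int.mul_emod, h] <;> omega

theorem Int.odd_or_odd_of_isCoprime {a b : ℤ} (h : IsCoprime a b) : a % 2 = 1 ∨ b % 2 = 1 := by
  by_contra hcon
  exact Int.not_even_and_even_of_isCoprime h (by omega) (by omega)

theorem Int.dvd_four_of_dvd {κ s u : ℤ} (hsu : IsCoprime s u) (hκ : 0 < κ) (hs : κ ∣ 4 * s ^ 2)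
    (hu : κ ∣ 4 * u ^ 2) : κ = 1 ∨ κ = 2 ∨ κ = 4 := by
  obtain ⟨x, y, hxy⟩ := hsu.pow (m := 2) (n := 2)
  have h4 : κ ∣ 4 := by
    rw [show (4 : ℤ) = x * (4 * s ^ 2) + y * (4 * u ^ 2) by linear_combination -4 * hxy]
    exact dvd_add (hs.mul_left _) (hu.mul_left _)
  have := Int.le_of_dvd (by norm_num) h4
  interval_cases κ <;> simp_all

theorem eq_zero_of_sq_add_sq_of_sq_sub_three_mul_sq (N : ℕ) : ∀ Q e z w : ℤ, IsCoprime Q e →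
    e.natAbs = N → Q ^ 2 + e ^ 2 = z ^ 2 → Q ^ 2 - 3 * e ^ 2 = w ^ 2 → e = 0 := by
  induction N using Nat.strong_induction_on with
  | _ N ih =>
  intro Q e z w hQe hN hz hw
  by_contra hne
  have hQ : Odd Q := by
    rw [Int.odd_iff]
    have := Int.odd_or_odd_of_isCoprime hQe
    rcases Int.sq_mod_eight Q with hQ | hQ <;> rcases Int.sq_mod_eight e with he | he <;>
    rcases Int.sq_mod_eight z with hz | hz <;> rcases Int.sq_mod_eight w with hw | hw <;> omega
  obtain ⟨a, b, rfl, rfl, hab, hodd⟩ := Int.exists_of_sq_add_sq hQe hQ hz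
  have ha : a ≠ 0 := by rintro rfl; simp at hne
  have hb : b ≠ 0 := by rintro rfl; simp at hne
  obtain ⟨g, h, hgh, hcop, hM⟩ := Int.exists_sq_add_three_sq (n := a * b) (w := w)
    (hQe.of_isCoprime_of_dvd_right ⟨2, by ring⟩) hQ (mul_ne_zero ha hb) (by rw [← hw]; ring)
  obtain ⟨r, s, u, v, rfl, rfl, rfl, rfl⟩ := Int.exists_four_factors ha hgh
  have hsu : IsCoprime s u := hab.of_mul_left_right.of_mul_right_left
  have hrv : IsCoprime r v := hab.of_mul_left_left.of_mul_right_right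
  have hr := left_ne_zero_of_mul ha
  have hs := right_ne_zero_of_mul ha
  have hu := left_ne_zero_of_mul hb
  have hr2 := sq_pos_of_ne_zero hr
  have hs2 := sq_pos_of_ne_zero hs
  have hu2 := sq_pos_of_ne_zero hu
  have hpar := Int.odd_or_odd_of_isCoprime hsu
  rcases hM with hM | hM
  · obtain ⟨κ, h1, h2⟩ := Int.exists_eq_mul_sq (P := s ^ 2 - 3 * u ^ 2) (R := s ^ 2 + u ^ 2) hrv
      (by linarith)
    have hκ : 0 < κ := by by_contra! hle; nlinarith
    rcases Int.dvd_four_of_dvd hsu hκ ⟨3 * r ^ 2 + v ^ 2, by linarith⟩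
      ⟨r ^ 2 - v ^ 2, by linarith⟩ with rfl | rfl | rfl
    · have hlt := Int.natAbs_lt_of_eq_two_mul (w := u) (t := r * s * v) hne (by ring)
      exact hu (ih _ (hN ▸ hlt) s u r v hsu rfl (by linarith) (by linarith))
    all_goals
      rcases Int.sq_mod_eight s with hs | hs <;> rcases Int.sq_mod_eight u with hu | hu <;>
      rcases Int.sq_mod_eight v with hv | hv <;> omega
  · obtain ⟨κ, h1, h2⟩ := Int.exists_eq_mul_sq (P := s ^ 2 + 3 * u ^ 2) (R := u ^ 2 - s ^ 2) hrv
      (by linarith)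
    have hκ : 0 < κ := by by_contra! hle; nlinarith
    rcases Int.dvd_four_of_dvd hsu hκ ⟨v ^ 2 - 3 * r ^ 2, by linarith⟩
      ⟨r ^ 2 + v ^ 2, by linarith⟩ with rfl | rfl | rfl
    · have := Int.odd_or_odd_of_isCoprime hab
      have hrs : (r * s) % 2 = (r % 2) * (s % 2) % 2 := Int.mul_emod ..
      have huv : (u * v) % 2 = (u % 2) * (v % 2) % 2 := Int.mul_emod ..
      rcases Int.sq_mod_eight s with hs | hs <;> rcases Int.sq_mod_eight u with hu | hu <;>
      rcases Int.sq_mod_eight v with hv | hv <;> rcases Int.sq_mod_eight r with hr | hr <;>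
      simp only [hs, hu, hv, hr] at hrs huv <;> omega
    · rcases Int.sq_mod_eight s with hs | hs <;> rcases Int.sq_mod_eight u with hu | hu <;>
      rcases Int.sq_mod_eight v with hv | hv <;> omega
    · have hlt := Int.natAbs_lt_of_eq_two_mul (w := r) (t := s * u * v) hne (by ring)
      exact hr (ih _ (hN ▸ hlt) v r u s hrv.symm rfl (by linarith) (by linarith))

theorem Int.exists_sq_and_exists_sq {a b c : ℤ} (hab : IsCoprime a b) (ha : 0 < a)
    (h : a * b = c ^ 2) : (∃ d, a = d ^ 2) ∧ ∃ e, b = e ^ 2 :=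
  ⟨Int.exists_sq_of_nonneg hab ha.le h, Int.exists_sq_of_nonneg hab.symm
    (nonneg_of_mul_nonneg_right (by rw [h]; positivity) ha) (by rw [← h, mul_comm])⟩

theorem Int.sq_add_sq_pos_of_isCoprime {s u : ℤ} (h : IsCoprime s u) : 0 < s ^ 2 + u ^ 2 := by
  rcases eq_or_ne s 0 with rfl | hs
  · have : u ≠ 0 := by rintro rfl; exact not_isUnit_zero (isCoprime_zero_right.1 h)
    positivity
  · positivity

theorem Int.exists_sq_sub_sq_of_mul {s u D : ℤ} (hsu : IsCoprime s u)
    (h : (s ^ 2 - u ^ 2) * (s ^ 2 + 3 * u ^ 2) = D ^ 2) :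
    ∃ A B, s ^ 2 - u ^ 2 = A ^ 2 ∧ s ^ 2 + 3 * u ^ 2 = B ^ 2 := by
  have hpos : 0 < s ^ 2 + 3 * u ^ 2 := by
    have := Int.sq_add_sq_pos_of_isCoprime hsu
    nlinarith [sq_nonneg u]
  have hpar := Int.odd_or_odd_of_isCoprime hsu
  by_cases hboth : s % 2 = 1 ∧ u % 2 = 1
  · obtain ⟨X, hX⟩ : (4 : ℤ) ∣ s ^ 2 - u ^ 2 := by
      rcases Int.sq_mod_eight s with hs | hs <;> rcases Int.sq_mod_eight u with hu | hu <;> omega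
    obtain ⟨Y, hY⟩ : (4 : ℤ) ∣ s ^ 2 + 3 * u ^ 2 := ⟨X + u ^ 2, by linarith⟩
    rw [hX, hY] at h
    obtain ⟨E, rfl⟩ : (4 : ℤ) ∣ D := (Int.pow_dvd_pow_iff two_ne_zero).1 ⟨X * Y, by linarith⟩
    have hcop : IsCoprime Y X := by
      refine isCoprime_of_prime_dvd ?_ fun π hπ hπY hπX => ?_
      · rintro ⟨rfl, rfl⟩; linarith
      · refine hπ.not_isUnit (hsu.isUnit_of_dvd' (hπ.dvd_of_dvd_pow (n := 2) ?_)
          (hπ.dvd_of_dvd_pow (n := 2) ?_))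
        · rw [show s ^ 2 = Y + 3 * X by linarith]; exact dvd_add hπY (hπX.mul_left _)
        · rw [show u ^ 2 = Y - X by linarith]; exact dvd_sub hπY hπX
    obtain ⟨⟨B, hB⟩, A, hA⟩ := Int.exists_sq_and_exists_sq (c := E) hcop (by linarith) (by linarith)
    exact ⟨2 * A, 2 * B, by rw [hX, hA]; ring, by rw [hY, hB]; ring⟩
  · have hcop : IsCoprime (s ^ 2 + 3 * u ^ 2) (s ^ 2 - u ^ 2) := by
      refine isCoprime_of_prime_dvd (fun h => hpos.ne' h.1) fun π hπ hπY hπX => ?_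
      have hπ2 : ¬ π ∣ 2 ^ 2 := by
        intro h2
        have h2 := (hπ.dvd_of_dvd_pow h2)
        have : IsCoprime π 2 := by
          refine IsCoprime.of_isCoprime_of_dvd_left (Int.isCoprime_two_right.2 ?_) hπX
          rw [Int.odd_iff]
          rcases Int.sq_mod_eight s with hs | hs <;>
            rcases Int.sq_mod_eight u with hu | hu <;> omega
        exact hπ.not_isUnit (this.isUnit_of_dvd' dvd_rfl h2)
      refine hπ.not_isUnit (hsu.isUnit_of_dvd' (hπ.dvd_of_dvd_pow (n := 2)
        ((hπ.dvd_or_dvd ?_).resolve_left hπ2))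
        (hπ.dvd_of_dvd_pow (n := 2) ((hπ.dvd_or_dvd ?_).resolve_left hπ2)))
      · rw [show 2 ^ 2 * s ^ 2 = (s ^ 2 + 3 * u ^ 2) + 3 * (s ^ 2 - u ^ 2) by ring]
        exact dvd_add hπY (hπX.mul_left _)
      · rw [show 2 ^ 2 * u ^ 2 = (s ^ 2 + 3 * u ^ 2) - (s ^ 2 - u ^ 2) by ring]
        exact dvd_sub hπY hπX
    obtain ⟨⟨B, hB⟩, A, hA⟩ := Int.exists_sq_and_exists_sq (c := D) hcop hpos (by linarith)
    exact ⟨A, B, hA, hB⟩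

theorem Int.exists_two_mul_sq_of_mul {s u D : ℤ} (hsu : IsCoprime s u)
    (h : (s ^ 2 + u ^ 2) * (3 * u ^ 2 - s ^ 2) = D ^ 2) :
    ∃ x y, x ^ 2 + y ^ 2 = u ^ 2 ∧ x ^ 2 + 4 * x * y + y ^ 2 = s ^ 2 := by
  have hpos := Int.sq_add_sq_pos_of_isCoprime hsu
  have hpar := Int.odd_or_odd_of_isCoprime hsu
  by_cases hboth : s % 2 = 1 ∧ u % 2 = 1
  · obtain ⟨X, hX⟩ : (2 : ℤ) ∣ s ^ 2 + u ^ 2 := by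
      rcases Int.sq_mod_eight s with hs | hs <;> rcases Int.sq_mod_eight u with hu | hu <;> omega
    obtain ⟨Y, hY⟩ : (2 : ℤ) ∣ 3 * u ^ 2 - s ^ 2 := ⟨2 * u ^ 2 - X, by linarith⟩
    have hXodd : Odd X := by
      rw [Int.odd_iff]
      rcases Int.sq_mod_eight s with hs | hs <;> rcases Int.sq_mod_eight u with hu | hu <;> omega
    rw [hX, hY] at h
    obtain ⟨E, rfl⟩ : (2 : ℤ) ∣ D := (Int.pow_dvd_pow_iff two_ne_zero).1 ⟨X * Y, by linarith⟩
    have hcop : IsCoprime X Y := by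
      refine isCoprime_of_prime_dvd ?_ fun π hπ hπX hπY => ?_
      · rintro ⟨rfl, rfl⟩; linarith
      · have hπ2 : ¬ π ∣ 2 := fun h2 => hπ.not_isUnit
          ((Int.isCoprime_two_right.2 hXodd).isUnit_of_dvd' hπX h2)
        refine hπ.not_isUnit (hsu.isUnit_of_dvd' (hπ.dvd_of_dvd_pow (n := 2)
          ((hπ.dvd_or_dvd ?_).resolve_left hπ2))
          (hπ.dvd_of_dvd_pow (n := 2) ((hπ.dvd_or_dvd ?_).resolve_left hπ2)))
        · rw [show 2 * s ^ 2 = 3 * X - Y by linarith]; exact dvd_sub (hπX.mul_left _) hπY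
        · rw [show 2 * u ^ 2 = X + Y by linarith]; exact dvd_add hπX hπY
    obtain ⟨⟨A, rfl⟩, B, rfl⟩ := Int.exists_sq_and_exists_sq (c := E) hcop (by linarith)
      (by linarith)
    have hAB : A % 2 = 1 ∧ B % 2 = 1 := by
      rcases Int.sq_mod_eight s with hs | hs <;> rcases Int.sq_mod_eight u with hu | hu <;>
      rcases Int.sq_mod_eight A with hA | hA <;> rcases Int.sq_mod_eight B with hB | hB <;> omega
    obtain ⟨x, hx⟩ : (2 : ℤ) ∣ A + B := by omega
    obtain ⟨y, hy⟩ : (2 : ℤ) ∣ A - B := by omega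
    obtain rfl : A = x + y := by omega
    obtain rfl : B = x - y := by omega
    exact ⟨x, y, by linarith, by linarith⟩
  · have hcop : IsCoprime (s ^ 2 + u ^ 2) (3 * u ^ 2 - s ^ 2) := by
      refine isCoprime_of_prime_dvd (fun h => hpos.ne' h.1) fun π hπ hπY hπX => ?_
      have hπ2 : ¬ π ∣ 2 ^ 2 := by
        intro h2
        have h2 := (hπ.dvd_of_dvd_pow h2)
        have : IsCoprime π 2 := by
          refine IsCoprime.of_isCoprime_of_dvd_left (Int.isCoprime_two_right.2 ?_) hπY
          rw [Int.odd_iff]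
          rcases Int.sq_mod_eight s with hs | hs <;>
            rcases Int.sq_mod_eight u with hu | hu <;> omega
        exact hπ.not_isUnit (this.isUnit_of_dvd' dvd_rfl h2)
      refine hπ.not_isUnit (hsu.isUnit_of_dvd' (hπ.dvd_of_dvd_pow (n := 2)
        ((hπ.dvd_or_dvd ?_).resolve_left hπ2))
        (hπ.dvd_of_dvd_pow (n := 2) ((hπ.dvd_or_dvd ?_).resolve_left hπ2)))
      · rw [show 2 ^ 2 * s ^ 2 = 3 * (s ^ 2 + u ^ 2) - (3 * u ^ 2 - s ^ 2) by ring]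
        exact dvd_sub (hπY.mul_left _) hπX
      · rw [show 2 ^ 2 * u ^ 2 = (s ^ 2 + u ^ 2) + (3 * u ^ 2 - s ^ 2) by ring]
        exact dvd_add hπY hπX
    obtain ⟨⟨B, hB⟩, A, hA⟩ := Int.exists_sq_and_exists_sq (c := D) hcop hpos (by linarith)
    exfalso
    rcases Int.sq_mod_eight s with hs | hs <;> rcases Int.sq_mod_eight u with hu | hu <;>
    rcases Int.sq_mod_eight A with hA' | hA' <;> omega

theorem Int.sq_eq_one_of_isCoprime_of_sq_eq {a b : ℤ} (h : IsCoprime a b) (he : a ^ 2 = b ^ 2) :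
    a ^ 2 = 1 := by
  have h2 := h.pow (m := 2) (n := 2)
  rw [← he, isCoprime_self] at h2
  rcases Int.isUnit_iff.1 h2 with h2 | h2
  · exact h2
  · nlinarith [sq_nonneg a]

theorem mul_eq_zero_of_sq_add_sq_of_sq_add_mul_add_sq (N : ℕ) : ∀ p q z w : ℤ, IsCoprime p q →
    (p ^ 2 + q ^ 2).natAbs = N → p ^ 2 + q ^ 2 = z ^ 2 → p ^ 2 + 4 * p * q + q ^ 2 = w ^ 2 →
    p * q = 0 := by
  induction N using Nat.strong_induction_on with
  | _ N ih =>
  have key : ∀ p q z w : ℤ, Odd p → IsCoprime p q → (p ^ 2 + q ^ 2).natAbs = N →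
      p ^ 2 + q ^ 2 = z ^ 2 → p ^ 2 + 4 * p * q + q ^ 2 = w ^ 2 → p * q = 0 := by
    intro p q z w hp hpq hN hz hw
    by_contra hne
    obtain ⟨k, l, rfl, rfl, hkl, hodd⟩ := Int.exists_of_sq_add_sq hpq hp hz
    have hk : k ≠ 0 := by rintro rfl; simp at hne
    have hl : l ≠ 0 := by rintro rfl; simp at hne
    obtain ⟨g, h, hgh, hcop, hM⟩ := Int.exists_sq_add_three_sq (n := k * l) (w := w)
      (M := k ^ 2 - l ^ 2 + 2 * (2 * k * l))
      (by simpa only [mul_comm (2 * k * l) 2] using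
        (hpq.add_mul_left_left 2).of_isCoprime_of_dvd_right ⟨2, by ring⟩)
      (hp.add_even (even_two_mul _)) (mul_ne_zero hk hl) (by rw [← hw]; ring)
    obtain ⟨r, s, u, v, rfl, rfl, rfl, rfl⟩ := Int.exists_four_factors hk hgh
    have hsu : IsCoprime s u := hkl.of_mul_left_right.of_mul_right_left
    have hrv : IsCoprime r v := hkl.of_mul_left_left.of_mul_right_right
    have hv := right_ne_zero_of_mul hl
    have hu := left_ne_zero_of_mul hl
    have hr := left_ne_zero_of_mul hk
    have fin : s ^ 2 = u ^ 2 → r ^ 2 = v ^ 2 → False := by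
      intro h1 h2
      have h3 := Int.sq_eq_one_of_isCoprime_of_sq_eq hsu h1
      have h4 := Int.sq_eq_one_of_isCoprime_of_sq_eq hrv h2
      have h5 : (r * s) ^ 2 = 1 := by rw [mul_pow, h3, h4, mul_one]
      have h6 : (u * v) ^ 2 = 1 := by rw [mul_pow, ← h1, ← h2, h3, h4, mul_one]
      rw [Int.odd_iff] at hodd
      rcases Int.sq_mod_eight (r * s) with h | h <;>
      rcases Int.sq_mod_eight (u * v) with h' | h' <;> omega
    rcases hM with hM | hM
    · have hD : (r * (s ^ 2 - 3 * u ^ 2) + 2 * s * u * v) ^ 2 =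
          v ^ 2 * ((s ^ 2 - u ^ 2) * (s ^ 2 + 3 * u ^ 2)) := by
        linear_combination (s ^ 2 - 3 * u ^ 2) * hM
      obtain ⟨D, hvD⟩ := (Int.pow_dvd_pow_iff two_ne_zero).1 ⟨_, hD⟩
      rw [hvD, mul_pow] at hD
      obtain ⟨A, B, hA, hB⟩ := Int.exists_sq_sub_sq_of_mul hsu
        (mul_left_cancel₀ (pow_ne_zero 2 hv) hD).symm
      have hAu : IsCoprime A u := by
        rw [← IsCoprime.pow_iff (m := 2) (n := 2) two_pos two_pos, ← hA]
        simpa [sub_eq_add_neg] using (hsu.pow (m := 2) (n := 2)).add_mul_left_left (-1)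
      have hAu0 := (mul_eq_zero.1 (eq_zero_of_sq_add_sq_of_sq_add_four_mul_sq _ A u s B hAu rfl
        (by linarith) (by linarith))).resolve_right hu
      have hsu2 : s ^ 2 = u ^ 2 := by rw [hAu0] at hA; linarith
      rcases sq_eq_sq_iff_eq_or_eq_neg.1 hsu2 with rfl | rfl
      · have : s ^ 2 * (r - v) ^ 2 = 0 := by linarith
        have := (mul_eq_zero.1 this).resolve_left (pow_ne_zero 2 hu)
        exact fin hsu2 (by rw [sub_eq_zero.1 (pow_eq_zero_iff two_ne_zero |>.1 this)])
      · have : u ^ 2 * (r + v) ^ 2 = 0 := by linarith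
        have := (mul_eq_zero.1 this).resolve_left (pow_ne_zero 2 hu)
        exact fin hsu2 (by
          rw [eq_neg_of_add_eq_zero_left (pow_eq_zero_iff two_ne_zero |>.1 this), neg_sq])
    · have hD : (r * (s ^ 2 + 3 * u ^ 2) + 2 * s * u * v) ^ 2 =
          v ^ 2 * ((s ^ 2 + u ^ 2) * (3 * u ^ 2 - s ^ 2)) := by
        linear_combination (s ^ 2 + 3 * u ^ 2) * hM
      obtain ⟨D, hvD⟩ := (Int.pow_dvd_pow_iff two_ne_zero).1 ⟨_, hD⟩
      rw [hvD, mul_pow] at hD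
      obtain ⟨x, y, hx, hy⟩ := Int.exists_two_mul_sq_of_mul hsu
        (mul_left_cancel₀ (pow_ne_zero 2 hv) hD).symm
      have hxy : IsCoprime x y := by
        refine isCoprime_of_prime_dvd ?_ fun π hπ hπx hπy => ?_
        · rintro ⟨rfl, rfl⟩
          exact hu (pow_eq_zero_iff two_ne_zero |>.1 (by linarith))
        · refine hπ.not_isUnit (hsu.isUnit_of_dvd' (hπ.dvd_of_dvd_pow (n := 2) ?_)
            (hπ.dvd_of_dvd_pow (n := 2) ?_))
          · rw [← hy]
            exact dvd_add (dvd_add (dvd_pow hπx two_ne_zero) (hπy.mul_left _))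
              (dvd_pow hπy two_ne_zero)
          · rw [← hx]
            exact dvd_add (dvd_pow hπx two_ne_zero) (dvd_pow hπy two_ne_zero)
      have hlt : (x ^ 2 + y ^ 2).natAbs < N := by
        rw [← hN, hx]
        zify
        rw [abs_of_nonneg (by positivity), abs_of_nonneg (by positivity)]
        have h1 : 0 < (r * s) ^ 2 := by positivity
        have h2 : u ^ 2 * 1 ≤ u ^ 2 * v ^ 2 :=
          mul_le_mul_of_nonneg_left (by have : 0 < v ^ 2 := by positivity
                                        linarith) (sq_nonneg u)
        have h3 : 0 < (u * v) ^ 2 := by positivity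
        nlinarith [mul_pos h1 h3]
      have hxy0 := ih _ hlt x y u s hxy rfl hx hy
      have hsu2 : s ^ 2 = u ^ 2 := by linarith
      rcases sq_eq_sq_iff_eq_or_eq_neg.1 hsu2 with rfl | rfl
      · have : 4 * s ^ 2 * r * (r + v) = 0 := by linarith
        have := (mul_eq_zero.1 this).resolve_left (by positivity)
        exact fin hsu2 (by rw [eq_neg_of_add_eq_zero_left this, neg_sq])
      · have : 4 * u ^ 2 * r * (r - v) = 0 := by linarith
        have := (mul_eq_zero.1 this).resolve_left (by positivity)
        exact fin hsu2 (by rw [sub_eq_zero.1 this])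
  intro p q z w hpq hN hz hw
  rcases Int.odd_or_odd_of_isCoprime hpq with hp | hq
  · exact key p q z w (Int.odd_iff.2 hp) hpq hN hz hw
  · rw [mul_comm]
    exact key q p z w (Int.odd_iff.2 hq) hpq.symm (by rw [add_comm, hN]) (by linarith)
      (by linarith)

theorem Prime.not_dvd_mul_of_dvd_sq_add_mul_add_sq {p q π k : ℤ} (hpq : IsCoprime p q)
    (hπ : Prime π) (h : π ∣ p ^ 2 + k * (p * q) + q ^ 2) : ¬ π ∣ p * q := by
  intro hd
  have hsum : π ∣ p ^ 2 + q ^ 2 := by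
    rw [show p ^ 2 + q ^ 2 = (p ^ 2 + k * (p * q) + q ^ 2) - k * (p * q) by ring]
    exact dvd_sub h (hd.mul_left k)
  rcases hπ.dvd_or_dvd hd with hp | hq
  · exact hπ.not_isUnit (hpq.isUnit_of_dvd' hp
      (hπ.dvd_of_dvd_pow ((dvd_add_right (dvd_pow hp two_ne_zero)).1 hsum)))
  · exact hπ.not_isUnit (hpq.isUnit_of_dvd'
      (hπ.dvd_of_dvd_pow ((dvd_add_left (dvd_pow hq two_ne_zero)).1 hsum)) hq)

theorem Prime.not_dvd_two_of_dvd_odd {π a : ℤ} (hπ : Prime π) (ha : Odd a) (h : π ∣ a) :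
    ¬ π ∣ 2 := fun h2 =>
  hπ.not_isUnit ((Int.isCoprime_two_right.2 ha).isUnit_of_dvd' h h2)

theorem isCoprime_of_dvd_sq_add_sq {p q F : ℤ} (hpq : IsCoprime p q) (hF : Odd F)
    (hd : F ∣ p ^ 2 + q ^ 2) : IsCoprime F ((p ^ 2 + 4 * p * q + q ^ 2) *
      ((p + q) * (p ^ 3 + 3 * p ^ 2 * q - p * q ^ 2 + q ^ 3))) := by
  refine isCoprime_of_prime_dvd ?_ fun π hπ hπF hπ' => ?_
  · rintro ⟨rfl, -⟩; simp at hF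
  · have h2 := hπ.not_dvd_two_of_dvd_odd hF hπF
    have hπF := hπF.trans hd
    have hnd := hπ.not_dvd_mul_of_dvd_sq_add_mul_add_sq (k := 0) hpq (by simpa using hπF)
    have hs : ¬ π ∣ p + q := by
      intro h
      have : π ∣ 2 * (p * q) := by
        rw [show 2 * (p * q) = (p + q) * (p + q) - (p ^ 2 + q ^ 2) by ring]
        exact dvd_sub (h.mul_left _) hπF
      exact (hπ.dvd_or_dvd this).elim h2 hnd
    rcases hπ.dvd_or_dvd hπ' with h | h
    · have : π ∣ 2 * (2 * (p * q)) := by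
        rw [show 2 * (2 * (p * q)) = (p ^ 2 + 4 * p * q + q ^ 2) - (p ^ 2 + q ^ 2) by ring]
        exact dvd_sub h hπF
      exact (hπ.dvd_or_dvd this).elim h2 fun h => (hπ.dvd_or_dvd h).elim h2 hnd
    rcases hπ.dvd_or_dvd h with h | h
    · exact hs h
    · have : π ∣ 2 * (q ^ 2 * (p + q)) := by
        rw [show 2 * (q ^ 2 * (p + q)) = (p + 3 * q) * (p ^ 2 + q ^ 2) -
          (p ^ 3 + 3 * p ^ 2 * q - p * q ^ 2 + q ^ 3) by ring]
        exact dvd_sub (hπF.mul_left _) h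
      exact (hπ.dvd_or_dvd this).elim h2 fun h => (hπ.dvd_or_dvd h).elim
        (fun h => hnd ((hπ.dvd_of_dvd_pow h).mul_left _)) hs

theorem isCoprime_of_dvd_sq_add_mul_add_sq {p q G : ℤ} (hpq : IsCoprime p q) (hG : Odd G)
    (hd : G ∣ p ^ 2 + 4 * p * q + q ^ 2) : IsCoprime G ((p ^ 2 + q ^ 2) *
      ((p + q) * (p ^ 3 + 3 * p ^ 2 * q - p * q ^ 2 + q ^ 3))) := by
  refine isCoprime_of_prime_dvd ?_ fun π hπ hπG hπ' => ?_
  · rintro ⟨rfl, -⟩; simp at hG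
  · have h2 := hπ.not_dvd_two_of_dvd_odd hG hπG
    have hπG := hπG.trans hd
    have hnd := hπ.not_dvd_mul_of_dvd_sq_add_mul_add_sq (k := 4) hpq (by rwa [← mul_assoc])
    have hs : ¬ π ∣ p + q := by
      intro h
      have : π ∣ 2 * (p * q) := by
        rw [show 2 * (p * q) = (p ^ 2 + 4 * p * q + q ^ 2) - (p + q) * (p + q) by ring]
        exact dvd_sub hπG (h.mul_left _)
      exact (hπ.dvd_or_dvd this).elim h2 hnd
    rcases hπ.dvd_or_dvd hπ' with h | h
    · have : π ∣ 2 * (2 * (p * q)) := by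
        rw [show 2 * (2 * (p * q)) = (p ^ 2 + 4 * p * q + q ^ 2) - (p ^ 2 + q ^ 2) by ring]
        exact dvd_sub hπG h
      exact (hπ.dvd_or_dvd this).elim h2 fun h => (hπ.dvd_or_dvd h).elim h2 hnd
    rcases hπ.dvd_or_dvd h with h | h
    · exact hs h
    · have : π ∣ 2 * (q ^ 2 * (p + q)) := by
        rw [show 2 * (q ^ 2 * (p + q)) = (p ^ 3 + 3 * p ^ 2 * q - p * q ^ 2 + q ^ 3) -
          (p - q) * (p ^ 2 + 4 * p * q + q ^ 2) by ring]
        exact dvd_sub h (hπG.mul_left _)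
      exact (hπ.dvd_or_dvd this).elim h2 fun h => (hπ.dvd_or_dvd h).elim
        (fun h => hnd ((hπ.dvd_of_dvd_pow h).mul_left _)) hs

theorem exists_half_factors_of_odd {p q : ℤ} (hp : p % 2 = 1) (hq : q % 2 = 1) :
    ∃ F G : ℤ, p ^ 2 + q ^ 2 = 2 * F ∧ p ^ 2 + 4 * p * q + q ^ 2 = 2 * G ∧ F % 4 = 1 ∧
      G % 4 = 3 := by
  have h : p * q % 2 = 1 := by rw [Int.mul_emod, hp, hq]; rfl
  obtain ⟨m, hm⟩ : ∃ m, p * q = 2 * m + 1 := ⟨p * q / 2, by omega⟩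
  have hF : (p ^ 2 + q ^ 2) % 8 = 2 := by
    rcases Int.sq_mod_eight p with h | h <;> rcases Int.sq_mod_eight q with h' | h' <;> omega
  obtain ⟨F, hF'⟩ : ∃ F, p ^ 2 + q ^ 2 = 2 * F := ⟨(p ^ 2 + q ^ 2) / 2, by omega⟩
  exact ⟨F, F + 4 * m + 2, hF', by linarith, by omega, by omega⟩

theorem mul_eq_zero_of_quartic_two {p q y : ℤ} (hpq : IsCoprime p q)
    (hy : (p ^ 2 + q ^ 2) * (p ^ 2 + 4 * p * q + q ^ 2) = y ^ 2) : p * q = 0 := by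
  have hpar := Int.odd_or_odd_of_isCoprime hpq
  by_cases hboth : p % 2 = 1 ∧ q % 2 = 1
  · exfalso
    obtain ⟨F, G, hF, hG, hF4, hG4⟩ := exists_half_factors_of_odd hboth.1 hboth.2
    rw [hF, hG] at hy
    obtain ⟨z, rfl⟩ : (2 : ℤ) ∣ y := (Int.pow_dvd_pow_iff two_ne_zero).1 ⟨F * G, by linarith⟩
    have h1 : F * G = z ^ 2 := by linarith
    have h2 : F * G % 4 = 3 := by rw [Int.mul_emod, hF4, hG4]; rfl
    rcases Int.sq_mod_eight z with h | h <;> omega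
  · have hFodd : Odd (p ^ 2 + q ^ 2) := by
      rw [Int.odd_iff]
      rcases Int.sq_mod_eight p with h | h <;> rcases Int.sq_mod_eight q with h' | h' <;> omega
    obtain ⟨⟨z, hz⟩, w, hw⟩ := Int.exists_sq_and_exists_sq
      (isCoprime_of_dvd_sq_add_sq hpq hFodd dvd_rfl).of_mul_right_left
      (Int.sq_add_sq_pos_of_isCoprime hpq) hy
    exact mul_eq_zero_of_sq_add_sq_of_sq_add_mul_add_sq _ p q z w hpq rfl hz hw

theorem add_eq_zero_or_mul_eq_zero_of_octic {p q w : ℤ} (hpq : IsCoprime p q)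
    (hw : (p ^ 2 + q ^ 2) * ((p ^ 2 + 4 * p * q + q ^ 2) *
      ((p + q) * (p ^ 3 + 3 * p ^ 2 * q - p * q ^ 2 + q ^ 3))) = w ^ 2) :
    p + q = 0 ∨ p * q = 0 := by
  have hpar := Int.odd_or_odd_of_isCoprime hpq
  have hpos := Int.sq_add_sq_pos_of_isCoprime hpq
  by_cases hboth : p % 2 = 1 ∧ q % 2 = 1
  · left
    obtain ⟨F, G, hF, hG, hF4, hG4⟩ := exists_half_factors_of_odd hboth.1 hboth.2
    have hFc := (isCoprime_of_dvd_sq_add_sq hpq (Int.odd_iff.2 (by omega))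
      ⟨2, by rw [hF, mul_comm]⟩ : IsCoprime F _)
    have hGc := (isCoprime_of_dvd_sq_add_mul_add_sq hpq (Int.odd_iff.2 (by omega))
      ⟨2, by rw [hG, mul_comm]⟩ : IsCoprime G _)
    rw [hF, hG] at hw
    rw [hG] at hFc
    rw [hF] at hGc
    generalize (p + q) * (p ^ 3 + 3 * p ^ 2 * q - p * q ^ 2 + q ^ 3) = H at *
    obtain ⟨z, rfl⟩ : (2 : ℤ) ∣ w :=
      (Int.pow_dvd_pow_iff two_ne_zero).1 ⟨F * (G * H), by rw [← hw]; ring⟩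
    obtain ⟨d, hd⟩ := Int.exists_sq_of_nonneg (c := z) (b := G * H)
      (hFc.of_isCoprime_of_dvd_right ⟨2, by ring⟩) (by linarith) (by linarith)
    obtain ⟨e, he⟩ := Int.sq_of_isCoprime (c := z) (b := F * H)
      (hGc.of_isCoprime_of_dvd_right ⟨2, by ring⟩) (by linarith)
    have he : G = - e ^ 2 := he.resolve_left fun h => by
      rcases Int.sq_mod_eight e with h | h <;> omega
    obtain ⟨s, hs⟩ : (2 : ℤ) ∣ q + p := by omega
    obtain ⟨r, hr⟩ : (2 : ℤ) ∣ q - p := by omega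
    obtain rfl : q = s + r := by omega
    obtain rfl : p = s - r := by omega
    have hrs : IsCoprime r s := by
      obtain ⟨a, b, hab⟩ := hpq
      exact ⟨b - a, a + b, by linarith⟩
    have := eq_zero_of_sq_add_sq_of_sq_sub_three_mul_sq _ r s d e hrs rfl (by linarith)
      (by linarith)
    linarith
  · right
    have hpq2 : p * q % 2 = 0 := by
      rcases hpar with h | h
      · rw [Int.mul_emod, show q % 2 = 0 by omega]; simp
      · rw [Int.mul_emod, show p % 2 = 0 by omega]; simp
    have hFodd : (p ^ 2 + q ^ 2) % 2 = 1 := by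
      rcases Int.sq_mod_eight p with h | h <;> rcases Int.sq_mod_eight q with h' | h' <;> omega
    have hGF : p ^ 2 + 4 * p * q + q ^ 2 = p ^ 2 + q ^ 2 + 4 * (p * q) := by ring
    obtain ⟨d, hd⟩ := Int.exists_sq_of_nonneg
      (isCoprime_of_dvd_sq_add_sq hpq (Int.odd_iff.2 hFodd) dvd_rfl) hpos.le hw
    obtain ⟨e, he⟩ := Int.sq_of_isCoprime (c := w)
      (isCoprime_of_dvd_sq_add_mul_add_sq hpq (Int.odd_iff.2 (by omega)) dvd_rfl) (by linarith)
    refine mul_eq_zero_of_sq_add_sq_of_sq_add_mul_add_sq _ p q d e hpq rfl hd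
      (he.resolve_right fun h => ?_)
    rcases Int.sq_mod_eight d with hd' | hd' <;> rcases Int.sq_mod_eight e with he' | he' <;> omega

theorem eq_zero_of_sq_eq {t y : ℚ} (h : y ^ 2 = (t ^ 2 + 1) * (t ^ 2 + 4 * t + 1)) : t = 0 := by
  have hq : (t.den : ℚ) ≠ 0 := by exact_mod_cast t.den_ne_zero
  have ht : t = t.num / t.den := t.num_div_den.symm
  obtain ⟨z, hz⟩ : IsSquare ((t.num ^ 2 + (t.den : ℤ) ^ 2) *
      (t.num ^ 2 + 4 * t.num * t.den + (t.den : ℤ) ^ 2)) := by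
    rw [← Rat.isSquare_intCast_iff]
    refine ⟨y * t.den ^ 2, ?_⟩
    push_cast
    rw [← sq, mul_pow, h]
    generalize (t.num : ℚ) = p at *
    generalize (t.den : ℚ) = q at *
    subst ht
    field_simp
  exact Rat.num_eq_zero.1 ((mul_eq_zero.1 (mul_eq_zero_of_quartic_two (isCoprime_num_den t)
    (by rw [hz, sq]))).resolve_right (by exact_mod_cast t.den_ne_zero))

theorem eq_zero_or_eq_neg_one_of_sq_eq_mul {t w : ℚ}
    (h : w ^ 2 = (t + 1) * (t ^ 3 + 3 * t ^ 2 - t + 1) * ((t ^ 2 + 1) * (t ^ 2 + 4 * t + 1))) :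
    t = 0 ∨ t = -1 := by
  have hq : (t.den : ℚ) ≠ 0 := by exact_mod_cast t.den_ne_zero
  have ht : t = t.num / t.den := t.num_div_den.symm
  obtain ⟨z, hz⟩ : IsSquare ((t.num ^ 2 + (t.den : ℤ) ^ 2) *
      ((t.num ^ 2 + 4 * t.num * t.den + (t.den : ℤ) ^ 2) * ((t.num + t.den) *
      (t.num ^ 3 + 3 * t.num ^ 2 * t.den - t.num * t.den ^ 2 + (t.den : ℤ) ^ 3)))) := by
    rw [← Rat.isSquare_intCast_iff]
    refine ⟨w * t.den ^ 4, ?_⟩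
    push_cast
    rw [← sq, mul_pow, h]
    generalize (t.num : ℚ) = p at *
    generalize (t.den : ℚ) = q at *
    subst ht
    field_simp
  rcases add_eq_zero_or_mul_eq_zero_of_octic (isCoprime_num_den t) (by rw [hz, sq]) with h | h
  · right
    have : (t.num : ℚ) + t.den = 0 := by exact_mod_cast h
    rw [ht]; field_simp; linarith
  · left
    exact Rat.num_eq_zero.1 ((mul_eq_zero.1 h).resolve_right (by exact_mod_cast t.den_ne_zero))

section QuadraticField

variable {K : Type*} [Field K] [NumberField K]

theorem eq_zero_of_add_mul_eq_zero {t : K} (ht : ∀ r : ℚ, (r : K) ≠ t) {a b : ℚ}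
    (h : (a : K) + b * t = 0) : a = 0 ∧ b = 0 := by
  have hb : b = 0 := by
    by_contra hb
    have hb' : (b : K) ≠ 0 := by exact_mod_cast hb
    refine ht (-a / b) ?_
    push_cast
    field_simp
    linear_combination -h
  subst hb
  exact ⟨by simpa using h, rfl⟩

theorem exists_eq_add_mul (hdeg : Module.finrank ℚ K = 2) {t : K} (ht : ∀ r : ℚ, (r : K) ≠ t)
    (x : K) : ∃ a b : ℚ, x = a + b * t := by
  have hli : LinearIndependent ℚ ![1, t] := by
    rw [LinearIndependent.pair_iff]
    intro a b h
    exact eq_zero_of_add_mul_eq_zero ht (by simpa [Algebra.smul_def] using h)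
  have hx : x ∈ Submodule.span ℚ (Set.range ![1, t]) := by
    rw [hli.span_eq_top_of_card_eq_finrank (by simp [hdeg])]
    trivial
  simp only [Matrix.range_cons, Matrix.range_empty, Set.union_empty, Set.singleton_union,
    Submodule.mem_span_pair] at hx
  obtain ⟨a, b, h⟩ := hx
  exact ⟨a, b, by simpa [Algebra.smul_def] using h.symm⟩

theorem eq_zero_or_eq_one_of_sq_eq {u y : ℚ} (h : y ^ 2 = 4 * u ^ 3 - 4 * u ^ 2 + 1) :
    u = 0 ∨ u = 1 := by
  by_cases hu : u = 0
  · exact Or.inl hu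
  · right
    have key : (y / u ^ 2) ^ 2 = (1 / u - 1 + 1) *
        ((1 / u - 1) ^ 3 + 3 * (1 / u - 1) ^ 2 - (1 / u - 1) + 1) := by
      rw [div_pow, h]
      field_simp
      ring
    rcases eq_zero_or_eq_neg_one_of_sq_eq key with h | h
    · field_simp at h
      linarith
    · field_simp at h
      linarith

theorem coeff_relation_of_sq_eq_cubic {u y : K} (hu : ∀ r : ℚ, (r : K) ≠ u) {a b l m : ℚ}
    (hab : u ^ 2 = a * u + b) (hy : y = m + l * u) (h : y ^ 2 = 4 * u ^ 3 - 4 * u ^ 2 + 1) :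
    a = 1 + b ^ 2 ∨ (a + b) ^ 2 = a := by
  have hlin : ((1 - m ^ 2 + 4 * a * b - (4 + l ^ 2) * b : ℚ) : K) +
      (4 * (a ^ 2 + b) - (4 + l ^ 2) * a - 2 * l * m : ℚ) * u = 0 := by
    push_cast
    subst hy
    linear_combination (-4 * u - 4 * a + 4 + l ^ 2) * hab - h
  obtain ⟨h0, h1⟩ := eq_zero_of_add_mul_eq_zero hu hlin
  have key : (l * ((4 + l ^ 2) / 4 - a) + m) ^ 2 = 4 * ((4 + l ^ 2) / 4 - a) ^ 3 -
      4 * ((4 + l ^ 2) / 4 - a) ^ 2 + 1 := by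
    linear_combination -h0 - ((4 + l ^ 2) / 4 - a) * h1
  rcases eq_zero_or_eq_one_of_sq_eq key with h | h
  · left
    have ha : a = 1 + l ^ 2 / 4 := by linarith
    subst ha
    have hb : b = l * m / 2 := by linarith
    have hm : m ^ 2 = 1 := by linarith
    rw [hb]
    linear_combination l ^ 2 / 4 * (- hm)
  · right
    have ha : a = l ^ 2 / 4 := by linarith
    subst ha
    have hb : b = l ^ 2 / 4 + l * m / 2 := by linarith
    rw [h] at key
    rw [hb]
    linear_combination l ^ 2 / 4 * key

theorem coeff_relation_of_sq_eq_quartic {t y : K} (ht : ∀ r : ℚ, (r : K) ≠ t) {a b l m : ℚ}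
    (hab : t ^ 2 = a * t + b) (hy : y = m + l * t)
    (h : y ^ 2 = (t ^ 2 + 1) * (t ^ 2 + 4 * t + 1)) :
    (b = -1 ∧ ∃ n, (2 * n - 4) * a + n ^ 2 = 0) ∨ (1 - b) * a = 2 * b := by
  obtain ⟨n, rfl⟩ : ∃ n, l = n + a := ⟨l - a, by ring⟩
  obtain ⟨k, rfl⟩ : ∃ k, m = k + b := ⟨m - b, by ring⟩
  have hy' : y = t ^ 2 + n * t + k := by rw [hy, hab]; push_cast; ring
  have hlin : (((2 * n - 4) * (a * b) + (n ^ 2 + 2 * k - 2) * b + (k ^ 2 - 1) : ℚ) : K) +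
      ((2 * n - 4) * (a ^ 2 + b) + (n ^ 2 + 2 * k - 2) * a + (2 * n * k - 4) : ℚ) * t = 0 := by
    rw [hy'] at h
    push_cast
    linear_combination h - ((2 * n - 4) * (t + a) + (n ^ 2 + 2 * k - 2)) * hab
  obtain ⟨h0, h1⟩ := eq_zero_of_add_mul_eq_zero ht hlin
  by_cases hn : n = 2
  · right
    subst hn
    have hk : k + 1 ≠ 0 := by
      intro hk
      obtain rfl : k = -1 := by linarith
      linarith
    have hb : k = 1 - 2 * b := by
      have : (k + 1) * (2 * b + k - 1) = 0 := by linarith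
      linarith [(mul_eq_zero.1 this).resolve_left hk]
    subst hb
    linarith
  · have hn' : 2 * n - 4 ≠ 0 := fun h => hn (by linarith)
    obtain ⟨r, hr⟩ : ∃ r, (2 * n - 4) * r = -(n ^ 2 + 2 * k - 2 + (2 * n - 4) * a) :=
      ⟨-(n ^ 2 + 2 * k - 2 + (2 * n - 4) * a) / (2 * n - 4), by field_simp⟩
    have key : (r ^ 2 + n * r + k) ^ 2 = (r ^ 2 + 1) * (r ^ 2 + 4 * r + 1) := by
      linear_combination h0 + r * h1 + (r ^ 2 - a * r - b) * hr
    obtain rfl := eq_zero_of_sq_eq key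
    have hk : (k - 1) * (k + 1) = 0 := by linear_combination key
    rcases mul_eq_zero.1 hk with hk | hk
    · left
      obtain rfl : k = 1 := by linarith
      have : (2 * n - 4) * (b + 1) = 0 := by linear_combination h1 - a * hr
      exact ⟨by linarith [(mul_eq_zero.1 this).resolve_left hn'], n, by linarith⟩
    · right
      obtain rfl : k = -1 := by linarith
      have : (2 * n - 4) * (n + 2 + 2 * a) = 0 := by linear_combination 2 * hr
      obtain rfl : n = -2 - 2 * a := by
        linarith [(mul_eq_zero.1 this).resolve_left hn']
      linear_combination h1 / 4 - a * hr / 4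

theorem false_of_irrational_parameter (hdeg : Module.finrank ℚ K = 2) {t x y : K}
    (ht : ∀ r : ℚ, (r : K) ≠ t) (hx : x ^ 2 = (t + 1) * (t ^ 3 + 3 * t ^ 2 - t + 1))
    (hy : y ^ 2 = (t ^ 2 + 1) * (t ^ 2 + 4 * t + 1)) : False := by
  obtain ⟨b, a, hab⟩ := exists_eq_add_mul hdeg ht (t ^ 2)
  rw [add_comm] at hab
  obtain ⟨m, l, hml⟩ := exists_eq_add_mul hdeg ht y
  have hb : b ≠ 0 := by
    rintro rfl
    have : t * (t - a) = 0 := by push_cast at hab; linear_combination hab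
    rcases mul_eq_zero.1 this with h | h
    · exact ht 0 (by rw [h, Rat.cast_zero])
    · exact ht a (sub_eq_zero.1 h).symm
  have hs : t + 1 ≠ 0 := fun h => ht (-1) (by push_cast; linear_combination -h)
  have hu : ∀ r : ℚ, (r : K) ≠ (t + 1)⁻¹ := by
    intro r hr
    refine ht (r⁻¹ - 1) ?_
    push_cast
    rw [hr, inv_inv]
    ring
  obtain ⟨m', l', hml'⟩ := exists_eq_add_mul hdeg hu (x * (t + 1)⁻¹ ^ 2)
  have hn : b - a - 1 ≠ 0 := by
    intro h
    have : (t + 1) * (t - (a + 1 : ℚ)) = 0 := by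
      have h' : (b - a - 1 : K) = 0 := by exact_mod_cast h
      push_cast
      linear_combination hab + h'
    exact ht _ (sub_eq_zero.1 ((mul_eq_zero.1 this).resolve_left hs)).symm
  have hn' : (b - a - 1 : K) ≠ 0 := by exact_mod_cast hn
  have hE1 : (b + 1) * a = b ^ 2 ∨ (b - 1) * a = 1 - 2 * b := by
    rcases coeff_relation_of_sq_eq_cubic hu (a := -(a + 2) / (b - a - 1)) (b := 1 / (b - a - 1))
      (by
        push_cast
        field_simp
        linear_combination -hab) hml' (by
        rw [mul_pow, hx]
        field_simp
        ring) with h | h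
    · left
      field_simp at h
      linear_combination h
    · right
      field_simp at h
      linear_combination h
  rcases coeff_relation_of_sq_eq_quartic ht hab hml hy with ⟨rfl, n, h⟩ | h
  · rcases hE1 with h' | h'
    · linarith
    · obtain rfl : a = -3 / 2 := by linarith
      nlinarith [sq_nonneg (n - 3 / 2)]
  · rcases hE1 with h' | h'
    · have : b * (b ^ 2 + b + 2) = 0 := by linear_combination (1 - b) * h' - (b + 1) * h
      have := (mul_eq_zero.1 this).resolve_left hb
      nlinarith [sq_nonneg (b + 1 / 2)]
    · linarith

theorem false_of_rational_parameter (hdeg : Module.finrank ℚ K = 2) {t : ℚ} {x y : K}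
    (h0 : t ≠ 0) (h1 : t ≠ -1) (hx : x ^ 2 = (t + 1) * (t ^ 3 + 3 * t ^ 2 - t + 1))
    (hy : y ^ 2 = (t ^ 2 + 1) * (t ^ 2 + 4 * t + 1)) : False := by
  by_cases hxr : ∃ r : ℚ, (r : K) = x
  · obtain ⟨r, rfl⟩ := hxr
    exact (eq_zero_or_eq_neg_one_of_sq_eq (x := r) (by exact_mod_cast hx)).elim h0 h1
  · push Not at hxr
    obtain ⟨a, b, rfl⟩ := exists_eq_add_mul hdeg hxr y
    have hlin : ((a ^ 2 + b ^ 2 * ((t + 1) * (t ^ 3 + 3 * t ^ 2 - t + 1)) -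
        (t ^ 2 + 1) * (t ^ 2 + 4 * t + 1) : ℚ) : K) + (2 * a * b : ℚ) * x = 0 := by
      push_cast
      linear_combination hy - b ^ 2 * hx
    obtain ⟨h2, h3⟩ := eq_zero_of_add_mul_eq_zero hxr hlin
    rcases mul_eq_zero.1 h3 with ha | rfl
    · obtain rfl : a = 0 := by linarith
      refine (eq_zero_or_eq_neg_one_of_sq_eq_mul
        (w := b * ((t + 1) * (t ^ 3 + 3 * t ^ 2 - t + 1))) ?_).elim h0 h1
      linear_combination (t + 1) * (t ^ 3 + 3 * t ^ 2 - t + 1) * h2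
    · exact h0 (eq_zero_of_sq_eq (y := a) (by linarith))

end QuadraticField

theorem no_type_1_3_with_disjoint_1_2 {K : Type*} [Field K] [NumberField K]
    (hdeg : Module.finrank ℚ K = 2) (c : K) :
    ¬∃ α β : K, HasPreperiodicType c 1 3 α ∧ HasPreperiodicType c 1 2 β ∧
      β ≠ fc c α ∧ β ≠ -fc c α := by
  rintro ⟨α, β, ⟨⟨hα, -⟩, hα'⟩, ⟨⟨hβ, -⟩, hβ'⟩, h1, h2⟩
  simp only [Function.iterate_succ, Function.iterate_zero, Function.comp_apply, id_eq,
    Nat.reduceAdd, Nat.reduceSub] at hα hα' hβ hβ'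
  have hfc : ∀ z, fc c z = z ^ 2 + c := fun _ => rfl
  have hneg : ∀ z, fc c (fc c z) = fc c z → fc c z ≠ z → z = -fc c z := by
    intro z hz hne
    have : (fc c z) ^ 2 = z ^ 2 := add_right_cancel (b := c) (by rw [← hfc, ← hfc, hz])
    rcases sq_eq_sq_iff_eq_or_eq_neg.1 this with h | h
    · exact (hne h).elim
    · rw [h, neg_neg]
  have hδ := hneg _ hα hα'
  have hε := hneg _ hβ hβ'
  generalize fc c (fc c (fc c α)) = a at hα hα' hδ
  generalize fc c (fc c β) = b at hβ hβ' hε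
  rw [hδ] at hα'
  generalize hγ : fc c α = γ at *
  rw [hfc] at hα hδ hβ hε hγ
  have ha : a ≠ 0 := by rintro rfl; simp at hα'
  have hb : (b - a) * (b - (1 - a)) = 0 := by linear_combination hβ - hα
  rcases mul_eq_zero.1 hb with hb | hb
  · have : β ^ 2 = γ ^ 2 := by linear_combination hε - hδ - hb
    exact (sq_eq_sq_iff_eq_or_eq_neg.1 this).elim h1 h2
  obtain ⟨t, ht⟩ : ∃ t, t = a - 1 + γ := ⟨_, rfl⟩
  obtain ⟨v, hv⟩ : ∃ v, v = a - 1 - γ := ⟨_, rfl⟩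
  have htv : t * v = 1 := by rw [ht, hv]; linear_combination hα - hδ
  have ht0 : t ≠ 0 := left_ne_zero_of_mul_eq_one htv
  have ht1 : t ≠ -1 := by
    intro h
    have : 2 * a = 0 := by linear_combination (a - γ) * (h - ht) - hα + hδ
    exact ha (by simpa using this)
  have hx : (2 * t * α) ^ 2 = (t + 1) * (t ^ 3 + 3 * t ^ 2 - t + 1) := by
    have h4 : 4 * α ^ 2 = 4 * t + (t + v) ^ 2 := by
      rw [ht, hv]; linear_combination 4 * hγ - 4 * hα
    linear_combination t ^ 2 * h4 + (2 * t ^ 2 + t * v + 1) * htv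
  have hy : (2 * t * β) ^ 2 = (t ^ 2 + 1) * (t ^ 2 + 4 * t + 1) := by
    have h4 : 4 * β ^ 2 = 4 * (t + v) + (t + v) ^ 2 := by
      rw [ht, hv]; linear_combination 4 * hε - 4 * hα - 4 * hb
    linear_combination t ^ 2 * h4 + (2 * t ^ 2 + t * v + 1 + 4 * t) * htv
  by_cases htr : ∃ r : ℚ, (r : K) = t
  · obtain ⟨r, rfl⟩ := htr
    exact false_of_rational_parameter hdeg (by exact_mod_cast ht0) (by exact_mod_cast ht1) hx hy
  · exact false_of_irrational_parameter hdeg (not_exists.1 htr) hx hy
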